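/- arXiv:2004.14655 — 8 statements merged into one kernel-verified Lean document; each statement's English description precedes it below -/
import Mathlib

section
/- For a compact Hausdorff space K, the Banach space C(K) of real-valued continuous functions on K with the supremum norm admits an equivalent URED norm if and only if K supports a strictly positive measure. -/
open MeasureTheory Filter Topology

/-- `N` is a norm on the real vector space `X`. -/
def IsNormOn {X : Type*} [AddCommGroup X] [Module ℝ X] (N : X → ℝ) : Prop :=
  (∀ x y : X, N (x + y) ≤ N x + N y) ∧
  (∀ (a : ℝ) (x : X), N (a • x) = |a| * N x) ∧
  (∀ x : X, N x = 0 → x = 0)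

/-- `N` is uniformly rotund in every direction (URED). -/
def IsUREDNorm {X : Type*} [AddCommGroup X] [Module ℝ X] (N : X → ℝ) : Prop :=
  ∀ (x y : ℕ → X) (z : X) (r : ℕ → ℝ),
    (∀ n, N (x n) = 1) → (∀ n, N (y n) = 1) →
    Tendsto (fun n => N ((2⁻¹ : ℝ) • (x n + y n))) atTop (𝓝 1) →
    (∀ n, x n - y n = r n • z) →
    Tendsto (fun n => N (x n - y n)) atTop (𝓝 0)

section Norms

variable {X : Type*} [AddCommGroup X] [Module ℝ X] {N : X → ℝ}

lemma IsNormOn.map_zero (hN : IsNormOn N) : N 0 = 0 := by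
  simpa using hN.2.1 0 0

lemma IsNormOn.map_neg (hN : IsNormOn N) (x : X) : N (-x) = N x := by
  simpa using hN.2.1 (-1) x

lemma IsNormOn.nonneg (hN : IsNormOn N) (x : X) : 0 ≤ N x := by
  have h := hN.1 x (-x)
  rw [add_neg_cancel, hN.map_zero, hN.map_neg] at h
  linarith

lemma IsNormOn.pos (hN : IsNormOn N) {x : X} (hx : x ≠ 0) : 0 < N x :=
  (hN.nonneg x).lt_of_ne fun h => hx (hN.2.2 x h.symm)

/-- A lower bound, along a line, for a norm that is at most `M` one step to either side. -/
lemma IsNormOn.sub_mul_le (hN : IsNormOn N) {M : ℝ} {g z : X} (h₁ : N (g + z) ≤ M)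
    (h₂ : N (g - z) ≤ M) (u : ℝ) : N g - |u| * (M - N g) ≤ N (g + u • z) := by
  have key : ∀ w : X, N (g - w) ≤ M → ∀ c : ℝ, 0 ≤ c →
      N g - c * (M - N g) ≤ N (g + c • w) := by
    intro w hw c hc
    have h := hN.1 (c • (g - w)) (g + c • w)
    rw [show c • (g - w) + (g + c • w) = (1 + c) • g by module, hN.2.1, hN.2.1,
      abs_of_nonneg hc, abs_of_nonneg (by linarith)] at h
    nlinarith [mul_le_mul_of_nonneg_left hw hc]
  rcases le_total 0 u with hu | hu
  · rw [abs_of_nonneg hu]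
    exact key z h₂ u hu
  · have h := key (-z) (by rwa [sub_neg_eq_add]) (-u) (by linarith)
    rw [abs_of_nonpos hu]
    simpa using h

/-- Along a ray on which the norm starts with value at most `M`, the value `M` is attained. -/
lemma IsNormOn.exists_eq (hN : IsNormOn N) {M : ℝ} {g z : X} (hz : z ≠ 0)
    (h₀ : N g ≤ M) (h₁ : N (g + z) ≤ M) :
    ∃ s : ℝ, 1 ≤ s ∧ s ≤ 2 * M / N z ∧ N (g + s • z) = M := by
  have hz' := hN.pos hz
  have lower : ∀ s : ℝ, 0 ≤ s → s * N z - N g ≤ N (g + s • z) := by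
    intro s hs
    have h := hN.1 (g + s • z) (-g)
    rw [show g + s • z + -g = s • z by abel, hN.2.1, hN.map_neg, abs_of_nonneg hs] at h
    linarith
  have hle : (1 : ℝ) ≤ 2 * M / N z := by
    have := lower 1 zero_le_one
    rw [one_smul] at this
    rw [le_div_iff₀ hz']
    linarith
  have hcont : Continuous fun s : ℝ => N (g + s • z) := by
    have aux : ∀ a b : ℝ, N (g + a • z) ≤ N (g + b • z) + N z * dist a b := by
      intro a b
      have h := hN.1 (g + b • z) ((a - b) • z)
      rw [show g + b • z + (a - b) • z = g + a • z by module, hN.2.1] at h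
      rw [Real.dist_eq]
      linarith
    exact (LipschitzWith.of_le_add_mul ⟨N z, hz'.le⟩ aux).continuous
  have hM : M ≤ N (g + (2 * M / N z) • z) := by
    have := lower (2 * M / N z) (by linarith)
    rw [div_mul_cancel₀ _ hz'.ne'] at this
    linarith
  obtain ⟨s, hs, h⟩ := intermediate_value_Icc hle hcont.continuousOn
    (show M ∈ Set.Icc _ _ from ⟨by simpa using h₁, hM⟩)
  exact ⟨s, hs.1, hs.2, h⟩

/-- A URED norm admits no asymptotically extreme points with a fixed two-sided room to move. -/
lemma IsUREDNorm.eq_zero (hN : IsNormOn N) (hU : IsUREDNorm N) {M : ℝ} {g : ℕ → X} {z : X}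
    (hlim : Tendsto (fun n => N (g n)) atTop (𝓝 M))
    (h₁ : ∀ n, N (g n + z) ≤ M) (h₂ : ∀ n, N (g n - z) ≤ M) : z = 0 := by
  by_contra hz
  have hz' := hN.pos hz
  have h₀ : ∀ n, N (g n) ≤ M := fun n => by
    have h := hN.1 (g n + z) (g n - z)
    rw [show g n + z + (g n - z) = (2 : ℝ) • g n by module, hN.2.1, abs_two] at h
    linarith [h₁ n, h₂ n]
  choose s hs₁ hsB hs using fun n => hN.exists_eq hz (h₀ n) (h₁ n)
  choose t ht₁ htB ht using fun n => hN.exists_eq (neg_ne_zero.2 hz) (h₀ n)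
    (by rw [← sub_eq_add_neg]; exact h₂ n)
  have hM : 0 < M := by
    have h := (hs₁ 0).trans (hsB 0)
    rw [le_div_iff₀ hz'] at h
    linarith
  set B : ℝ := 2 * M / N z
  have hmid : ∀ n, (2⁻¹ : ℝ) • (M⁻¹ • (g n + s n • z) + M⁻¹ • (g n + t n • -z)) =
      M⁻¹ • (g n + ((s n - t n) / 2) • z) := fun n => by module
  have hinv : ∀ x : X, N (M⁻¹ • x) = M⁻¹ * N x := fun x => by
    rw [hN.2.1, abs_of_pos (inv_pos.2 hM)]
  have hlim' := hU (fun n => M⁻¹ • (g n + s n • z)) (fun n => M⁻¹ • (g n + t n • -z)) z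
    (fun n => M⁻¹ * (s n + t n))
    (fun n => by rw [hinv, hs, inv_mul_cancel₀ hM.ne'])
    (fun n => by rw [hinv, ht, inv_mul_cancel₀ hM.ne'])
    ?_ (fun n => by module)
  · have hge : M⁻¹ * (2 * N z) ≤ 0 := by
      refine ge_of_tendsto' hlim' fun n => ?_
      rw [show M⁻¹ • (g n + s n • z) - M⁻¹ • (g n + t n • -z) = M⁻¹ • ((s n + t n) • z) by module,
        hinv, hN.2.1]
      have := le_abs_self (s n + t n)
      gcongr
      linarith [hs₁ n, ht₁ n]
    have : 0 < M⁻¹ * (2 * N z) := by positivity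
    linarith
  · have hlow : Tendsto (fun n => M⁻¹ * (N (g n) - B * (M - N (g n)))) atTop (𝓝 1) := by
      have h := (hlim.sub ((hlim.const_sub M).const_mul B)).const_mul M⁻¹
      simpa [hM.ne'] using h
    refine tendsto_of_tendsto_of_tendsto_of_le_of_le hlow tendsto_const_nhds
      (fun n => ?_) (fun n => ?_)
    · simp only [hmid, hinv]
      have h := hN.sub_mul_le (h₁ n) (h₂ n) ((s n - t n) / 2)
      have hB : |(s n - t n) / 2| ≤ B := by
        have := hN.map_neg z
        have hsB := hsB n
        have htB := htB n
        rw [this] at htB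
        rw [abs_le]
        constructor <;> linarith [hs₁ n, ht₁ n]
      have := mul_le_mul_of_nonneg_right hB (sub_nonneg.2 (h₀ n))
      gcongr
      linarith
    · have h := hN.1 (M⁻¹ • (g n + s n • z)) (M⁻¹ • (g n + t n • -z))
      rw [hinv, hinv, hs, ht, inv_mul_cancel₀ hM.ne'] at h
      simp only [hN.2.1 2⁻¹]
      rw [abs_of_pos (by norm_num)]
      linarith

/-- The norm induced by an injective linear map to a Hilbert space, combined with an arbitrary
norm, is URED. -/
lemma isUREDNorm_toLp_prod {E H : Type*} [NormedAddCommGroup E] [NormedSpace ℝ E]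
    [NormedAddCommGroup H] [InnerProductSpace ℝ H] (T : E →ₗ[ℝ] H)
    (hT : Function.Injective T) : IsUREDNorm fun x : E => ‖WithLp.toLp 2 (x, T x)‖ := by
  have hsq : ∀ x : E, ‖WithLp.toLp 2 (x, T x)‖ ^ 2 = ‖x‖ ^ 2 + ‖T x‖ ^ 2 := fun x =>
    WithLp.prod_norm_sq_eq_of_L2 _
  have hsmul : ∀ (a : ℝ) (x : E), ‖WithLp.toLp 2 (a • x, T (a • x))‖ =
      |a| * ‖WithLp.toLp 2 (x, T x)‖ := fun a x => by
    rw [map_smul, ← Prod.smul_mk, WithLp.toLp_smul, norm_smul, Real.norm_eq_abs]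
  intro x y z r hx hy hmid hxy
  simp only [hxy, hsmul] at hx hy hmid ⊢
  rcases eq_or_ne z 0 with rfl | hz
  · simp
  have hTz : 0 < ‖T z‖ := norm_pos_iff.2 ((map_ne_zero_iff T hT).2 hz)
  have hbound : ∀ n, (|r n| * ‖T z‖) ^ 2 ≤
      4 - 4 * (|(2⁻¹ : ℝ)| * ‖WithLp.toLp 2 (x n + y n, T (x n + y n))‖) ^ 2 := by
    intro n
    have hpar := parallelogram_law_with_norm ℝ (T (x n)) (T (y n))
    rw [← map_sub, hxy, map_smul, norm_smul, Real.norm_eq_abs, ← map_add] at hpar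
    have hadd := norm_add_le (x n) (y n)
    have hx' := hsq (x n)
    have hy' := hsq (y n)
    rw [hx] at hx'
    rw [hy] at hy'
    have hhalf : |(2⁻¹ : ℝ)| = 2⁻¹ := abs_of_pos (by norm_num)
    rw [mul_pow |(2⁻¹ : ℝ)|, hsq, hhalf]
    nlinarith [sq_nonneg (‖x n‖ - ‖y n‖),
      pow_le_pow_left₀ (norm_nonneg _) hadd 2]
  have hlim : Tendsto (fun n => (|r n| * ‖T z‖) ^ 2) atTop (𝓝 0) := by
    refine squeeze_zero (fun n => sq_nonneg _) hbound ?_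
    simpa using ((hmid.pow 2).const_mul 4).const_sub 4
  have hlim' : Tendsto (fun n => |r n| * ‖T z‖) atTop (𝓝 0) := by
    have h := hlim.sqrt
    simp only [Real.sqrt_zero] at h
    exact h.congr fun n => Real.sqrt_sq (by positivity)
  have h := (hlim'.mul_const ‖T z‖⁻¹).mul_const ‖WithLp.toLp 2 (z, T z)‖
  simpa [mul_assoc, hTz.ne'] using h

end Norms

section PositiveFunctional

variable {K : Type*} [TopologicalSpace K]

/-- The supremum of `N` over the order interval `[-u⁺, u⁺]`. -/
noncomputable def orderIntervalSup (N : C(K, ℝ) → ℝ) (u : C(K, ℝ)) : ℝ :=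
  sSup (N '' {g | ∀ t, |g t| ≤ max (u t) 0})

lemma nonempty_image_orderInterval (N : C(K, ℝ) → ℝ) (u : C(K, ℝ)) :
    (N '' {g | ∀ t, |g t| ≤ max (u t) 0}).Nonempty :=
  ⟨N 0, 0, by simp, rfl⟩

variable [CompactSpace K] {N : C(K, ℝ) → ℝ} {C : ℝ}

lemma le_orderIntervalSup (hC : 0 < C) (hNC : ∀ f, N f ≤ C * ‖f‖) {u g : C(K, ℝ)}
    (hg : ∀ t, |g t| ≤ max (u t) 0) :
    N g ≤ orderIntervalSup N u := by
  refine le_csSup ⟨C * ‖u‖, ?_⟩ ⟨g, hg, rfl⟩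
  rintro _ ⟨f, hf, rfl⟩
  refine (hNC f).trans ?_
  gcongr
  refine (ContinuousMap.norm_le _ (norm_nonneg u)).2 fun t => (hf t).trans ?_
  exact max_le ((le_abs_self _).trans (u.norm_coe_le_norm t)) (norm_nonneg u)

lemma orderIntervalSup_smul (hC : 0 < C) (hNC : ∀ f, N f ≤ C * ‖f‖)
    (hN : IsNormOn N) {c : ℝ} (hc : 0 < c) (u : C(K, ℝ)) :
    orderIntervalSup N (c • u) = c * orderIntervalSup N u := by
  have key : ∀ (c : ℝ), 0 < c → ∀ u : C(K, ℝ),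
      c * orderIntervalSup N u ≤ orderIntervalSup N (c • u) := by
    intro c hc u
    rw [← le_div_iff₀' hc]
    refine csSup_le (nonempty_image_orderInterval N u) ?_
    rintro _ ⟨g, hg, rfl⟩
    rw [le_div_iff₀' hc]
    have h := le_orderIntervalSup hC hNC (u := c • u) (g := c • g) fun t => by
      have := mul_le_mul_of_nonneg_left (hg t) hc.le
      rw [mul_max_of_nonneg _ _ hc.le, mul_zero] at this
      simpa [abs_mul, abs_of_pos hc] using this
    rwa [hN.2.1, abs_of_pos hc] at h
  refine le_antisymm ?_ (key c hc u)
  have h := key c⁻¹ (inv_pos.2 hc) (c • u)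
  rwa [inv_smul_smul₀ hc.ne', inv_mul_le_iff₀ hc] at h

lemma orderIntervalSup_add_le (hC : 0 < C) (hNC : ∀ f, N f ≤ C * ‖f‖)
    (hN : IsNormOn N) (u v : C(K, ℝ)) :
    orderIntervalSup N (u + v) ≤ orderIntervalSup N u + orderIntervalSup N v := by
  refine csSup_le (nonempty_image_orderInterval N _) ?_
  rintro _ ⟨g, hg, rfl⟩
  set a : C(K, ℝ) := u ⊔ 0
  set w : C(K, ℝ) := (-a) ⊔ (g ⊓ a)
  have hw : ∀ t, w t = max (-max (u t) 0) (min (g t) (max (u t) 0)) := fun t => rfl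
  have h₁ : N w ≤ orderIntervalSup N u := le_orderIntervalSup hC hNC fun t => by
    rw [hw]
    grind
  have h₂ : N (g - w) ≤ orderIntervalSup N v := le_orderIntervalSup hC hNC fun t => by
    have := hg t
    rw [ContinuousMap.add_apply] at this
    rw [ContinuousMap.sub_apply, hw]
    grind
  calc N g = N (w + (g - w)) := by rw [add_sub_cancel]
    _ ≤ N w + N (g - w) := hN.1 _ _
    _ ≤ _ := add_le_add h₁ h₂

/-- Hahn–Banach: the supremum of `N` over the unit ball is the value at `1` of a positive linear
functional dominated by `orderIntervalSup N`. -/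
lemma exists_positive_functional [Nonempty K] (hC : 0 < C) (hNC : ∀ f, N f ≤ C * ‖f‖)
    (hN : IsNormOn N) :
    ∃ φ : C(K, ℝ) →ₗ[ℝ] ℝ, φ 1 = orderIntervalSup N 1 ∧
      (∀ u, φ u ≤ orderIntervalSup N u) ∧ ∀ u, 0 ≤ u → 0 ≤ φ u := by
  set p : C(K, ℝ) →ₗ.[ℝ] ℝ :=
    LinearPMap.mkSpanSingleton (K := ℝ) (1 : C(K, ℝ)) (orderIntervalSup N 1) one_ne_zero
  have hdom : ∀ x : p.domain, p x ≤ orderIntervalSup N x := by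
    rintro ⟨x, hx⟩
    obtain ⟨c, rfl⟩ := Submodule.mem_span_singleton.1 hx
    have h : p ⟨c • 1, hx⟩ = c * orderIntervalSup N 1 :=
      LinearPMap.mkSpanSingleton'_apply _ _ _ _ _
    rw [h]
    rcases lt_or_ge 0 c with hc | hc
    · exact (orderIntervalSup_smul hC hNC hN hc 1).ge
    · have h0 : ∀ u : C(K, ℝ), 0 ≤ orderIntervalSup N u := fun u =>
        hN.map_zero.ge.trans (le_orderIntervalSup hC hNC (by simp))
      exact (mul_nonpos_of_nonpos_of_nonneg hc (h0 1)).trans (h0 _)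
  obtain ⟨φ, hφ, hle⟩ := exists_extension_of_le_sublinear p (orderIntervalSup N)
    (fun c hc u => orderIntervalSup_smul hC hNC hN hc u)
    (orderIntervalSup_add_le hC hNC hN) hdom
  refine ⟨φ, ?_, hle, fun u hu => ?_⟩
  · rw [hφ ⟨1, Submodule.mem_span_singleton_self _⟩]
    exact LinearPMap.mkSpanSingleton'_apply_self _ _ _ _
  · have h : orderIntervalSup N (-u) ≤ 0 := by
      refine csSup_le (nonempty_image_orderInterval N _) ?_
      rintro _ ⟨g, hg, rfl⟩
      have : g = 0 := by
        ext t
        have h₁ := hg t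
        have h₂ : 0 ≤ u t := hu t
        rw [ContinuousMap.neg_apply, max_eq_right (by linarith)] at h₁
        simpa using h₁
      rw [this, hN.map_zero]
    have := (hle (-u)).trans h
    rw [map_neg] at this
    linarith

/-- If `N` is URED, the functional of `exists_positive_functional` is strictly positive. -/
lemma eq_zero_of_functional_eq_zero (hC : 0 < C) (hNC : ∀ f, N f ≤ C * ‖f‖)
    (hN : IsNormOn N) (hU : IsUREDNorm N)
    {φ : C(K, ℝ) →ₗ[ℝ] ℝ} (h1 : φ 1 = orderIntervalSup N 1)
    (hle : ∀ u, φ u ≤ orderIntervalSup N u) {f : C(K, ℝ)}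
    (hf₀ : ∀ t, 0 ≤ f t) (hf₁ : ∀ t, f t ≤ 1) (hf : φ f = 0) : f = 0 := by
  set M := orderIntervalSup N 1
  have hball : ∀ g : C(K, ℝ), (∀ t, |g t| ≤ 1) → N g ≤ M := fun g hg =>
    le_orderIntervalSup hC hNC fun t => (hg t).trans (le_max_left _ _)
  have hM : M ≤ orderIntervalSup N (1 - f) := by
    have := hle (1 - f)
    rwa [map_sub, hf, h1, sub_zero] at this
  have hex : ∀ n : ℕ, ∃ g : C(K, ℝ), (∀ t, |g t| ≤ 1 - f t) ∧ M - 1 / ((n : ℝ) + 1) < N g := by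
    intro n
    have hn : (0 : ℝ) < 1 / ((n : ℝ) + 1) := by positivity
    obtain ⟨_, ⟨g, hg, rfl⟩, h⟩ := exists_lt_of_lt_csSup (nonempty_image_orderInterval N (1 - f))
      (show M - 1 / ((n : ℝ) + 1) < orderIntervalSup N (1 - f) by linarith)
    refine ⟨g, fun t => (hg t).trans (max_le le_rfl ?_), h⟩
    exact sub_nonneg.2 (hf₁ t)
  choose g hg hgN using hex
  refine hU.eq_zero hN (g := g) (M := M) ?_ (fun n => hball _ fun t => ?_)
    (fun n => hball _ fun t => ?_)
  · refine tendsto_of_tendsto_of_tendsto_of_le_of_le ?_ tendsto_const_nhds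
      (fun n => (hgN n).le) (fun n => hball _ fun t => (hg n t).trans (by linarith [hf₀ t]))
    simpa using (tendsto_one_div_add_atTop_nhds_zero_nat (𝕜 := ℝ)).const_sub M
  · have := abs_le.1 (hg n t)
    rw [ContinuousMap.add_apply, abs_le]
    constructor <;> linarith [hf₀ t]
  · have := abs_le.1 (hg n t)
    rw [ContinuousMap.sub_apply, abs_le]
    constructor <;> linarith [hf₀ t]

/-- A strictly positive linear functional on `C(K, ℝ)` yields a strictly positive measure. -/
lemma exists_strictly_positive_measure [T2Space K] [MeasurableSpace K] [BorelSpace K]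
    (φ : C(K, ℝ) →ₗ[ℝ] ℝ) (hφ : ∀ u, 0 ≤ u → 0 ≤ φ u)
    (hpos : ∀ f : C(K, ℝ), (∀ t, 0 ≤ f t) → (∀ t, f t ≤ 1) → φ f = 0 → f = 0) :
    ∃ μ : Measure K, IsFiniteMeasure μ ∧ ∀ G : Set K, IsOpen G → G.Nonempty → 0 < μ G := by
  let Λ : CompactlySupportedContinuousMap K ℝ →ₚ[ℝ] ℝ := PositiveLinearMap.mk₀
    { toFun := fun f => φ f.toContinuousMap
      map_add' := fun f g => φ.map_add f.toContinuousMap g.toContinuousMap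
      map_smul' := fun c f => φ.map_smul c f.toContinuousMap } fun f hf => hφ _ hf
  refine ⟨RealRMK.rieszMeasure Λ, inferInstance, fun G hG ⟨t₀, ht₀⟩ => ?_⟩
  refine pos_iff_ne_zero.2 fun h0 => ?_
  obtain ⟨f, hf₀, hf₁, hf⟩ := exists_continuous_zero_one_of_isClosed hG.isClosed_compl
    (isClosed_singleton (x := t₀)) (by simpa using ht₀)
  have hint : φ f = 0 := by
    have h := RealRMK.integral_rieszMeasure Λ (CompactlySupportedContinuousMap.continuousMapEquiv f)
    refine Eq.trans h.symm (integral_eq_zero_of_ae ?_)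
    refine measure_mono_null (fun t ht => ?_) h0
    by_contra htG
    exact ht (hf₀ htG)
  have := hpos f (fun t => (hf t).1) (fun t => (hf t).2) hint
  have h1 : f t₀ = 1 := hf₁ rfl
  simp [this] at h1

end PositiveFunctional

/-- Theorem (Avilés–Troyanski): `C(K)` admits an equivalent URED norm iff `K` supports a
strictly positive (finite Borel) measure. -/
theorem stmt0 {K : Type*} [TopologicalSpace K] [CompactSpace K] [T2Space K]
    [MeasurableSpace K] [BorelSpace K] :
    (∃ N : C(K, ℝ) → ℝ, IsNormOn N ∧
      (∃ c : ℝ, 0 < c ∧ ∃ C : ℝ, 0 < C ∧ ∀ f : C(K, ℝ), N f ≤ C * ‖f‖ ∧ ‖f‖ ≤ c * N f) ∧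
      IsUREDNorm N) ↔
    (∃ μ : Measure K, IsFiniteMeasure μ ∧
      ∀ G : Set K, IsOpen G → G.Nonempty → 0 < μ G) := by
  constructor
  · rintro ⟨N, hN, ⟨_, -, C, hC, hequiv⟩, hU⟩
    rcases isEmpty_or_nonempty K with hK | hK
    · exact ⟨0, inferInstance, fun G _ ⟨t, _⟩ => hK.elim t⟩
    have hNC : ∀ f, N f ≤ C * ‖f‖ := fun f => (hequiv f).1
    obtain ⟨φ, h1, hle, hφ⟩ := exists_positive_functional hC hNC hN
    exact exists_strictly_positive_measure φ hφ fun f hf₀ hf₁ hf =>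
      eq_zero_of_functional_eq_zero hC hNC hN hU h1 hle hf₀ hf₁ hf
  · rintro ⟨μ, hμ, hpos⟩
    have : μ.IsOpenPosMeasure := ⟨fun G hG hne => (hpos G hG hne).ne'⟩
    let T : C(K, ℝ) →L[ℝ] Lp ℝ 2 μ := ContinuousMap.toLp 2 μ ℝ
    have hsq : ∀ f : C(K, ℝ), ‖WithLp.toLp 2 (f, T f)‖ ^ 2 = ‖f‖ ^ 2 + ‖T f‖ ^ 2 := fun f =>
      WithLp.prod_norm_sq_eq_of_L2 _
    have hle : ∀ f : C(K, ℝ), ‖f‖ ≤ ‖WithLp.toLp 2 (f, T f)‖ := fun f =>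
      le_of_sq_le_sq (by rw [hsq]; exact le_add_of_nonneg_right (sq_nonneg _)) (norm_nonneg _)
    refine ⟨fun f => ‖WithLp.toLp 2 (f, T f)‖, ⟨fun f g => ?_, fun a f => ?_, fun f hf => ?_⟩,
      ⟨1, one_pos, 1 + ‖T‖, by positivity, fun f => ⟨?_, ?_⟩⟩,
      isUREDNorm_toLp_prod T.toLinearMap (ContinuousMap.toLp_injective μ)⟩
    · beta_reduce
      rw [map_add, ← Prod.mk_add_mk, WithLp.toLp_add]
      exact norm_add_le _ _
    · beta_reduce
      rw [map_smul, ← Prod.smul_mk, WithLp.toLp_smul, norm_smul, Real.norm_eq_abs]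
    · exact norm_le_zero_iff.1 ((hle f).trans hf.le)
    · refine le_of_sq_le_sq ?_ (by positivity)
      rw [hsq]
      have h := pow_le_pow_left₀ (norm_nonneg _) (T.le_opNorm f) 2
      nlinarith [mul_nonneg (norm_nonneg T) (sq_nonneg ‖f‖)]
    · rw [one_mul]
      exact hle f
end

section
/- Let K be a compact Hausdorff space and μ a finite Borel measure on K with μ(G) > 0 for every nonempty open G ⊆ K. Then the norm |||f||| = sqrt(‖f‖_∞² + ∫_K f² dμ) on C(K) is equivalent to the supremum norm and is URED. -/
open MeasureTheory Filter Topology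

/-- The square of a continuous function is integrable for a finite measure on a compact space. -/
theorem integrable_sq_continuousMap {K : Type*} [TopologicalSpace K] [CompactSpace K]
    [MeasurableSpace K] [BorelSpace K] (μ : Measure K) [IsFiniteMeasure μ] (f : C(K, ℝ)) :
    Integrable (fun x => (f x) ^ 2) μ :=
  (f.continuous.pow 2).integrable_of_hasCompactSupport (HasCompactSupport.of_compactSpace _)

theorem integral_sq_continuousMap_le {K : Type*} [TopologicalSpace K] [CompactSpace K]
    [MeasurableSpace K] [BorelSpace K] (μ : Measure K) [IsFiniteMeasure μ] (f : C(K, ℝ)) :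
    ∫ x, (f x) ^ 2 ∂μ ≤ μ.real Set.univ * ‖f‖ ^ 2 := by
  calc ∫ x, (f x) ^ 2 ∂μ ≤ ∫ _, ‖f‖ ^ 2 ∂μ := by
        refine integral_mono (integrable_sq_continuousMap μ f) (integrable_const _) fun x => ?_
        exact sq_le_sq.2 (by simpa using f.norm_coe_le_norm x)
    _ = μ.real Set.univ * ‖f‖ ^ 2 := by simp

/-- The parallelogram law for the `L²` part. -/
theorem integral_sq_midpoint_continuousMap {K : Type*} [TopologicalSpace K] [CompactSpace K]
    [MeasurableSpace K] [BorelSpace K] (μ : Measure K) [IsFiniteMeasure μ] (f g : C(K, ℝ)) :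
    4 * ∫ x, (((2⁻¹ : ℝ) • (f + g)) x) ^ 2 ∂μ + ∫ x, ((f - g) x) ^ 2 ∂μ =
      2 * ∫ x, (f x) ^ 2 ∂μ + 2 * ∫ x, (g x) ^ 2 ∂μ := by
  simp only [← integral_const_mul]
  rw [← integral_add ((integrable_sq_continuousMap μ _).const_mul _)
      (integrable_sq_continuousMap μ _),
    ← integral_add ((integrable_sq_continuousMap μ _).const_mul _)
      ((integrable_sq_continuousMap μ _).const_mul _)]
  refine integral_congr_ae (.of_forall fun x => ?_)
  simp only [ContinuousMap.smul_apply, ContinuousMap.add_apply, ContinuousMap.sub_apply,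
    smul_eq_mul]
  ring

theorem integral_sq_smul_continuousMap {K : Type*} [TopologicalSpace K]
    [MeasurableSpace K] (μ : Measure K) (a : ℝ) (f : C(K, ℝ)) :
    ∫ x, ((a • f) x) ^ 2 ∂μ = a ^ 2 * ∫ x, (f x) ^ 2 ∂μ := by
  simp only [ContinuousMap.smul_apply, smul_eq_mul, mul_pow, integral_const_mul]

theorem integral_sq_pos_continuousMap {K : Type*} [TopologicalSpace K] [CompactSpace K]
    [MeasurableSpace K] [BorelSpace K] (μ : Measure K) [IsFiniteMeasure μ]
    [μ.IsOpenPosMeasure] {f : C(K, ℝ)} (hf : f ≠ 0) : 0 < ∫ x, (f x) ^ 2 ∂μ := by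
  obtain ⟨x, hx⟩ := DFunLike.ne_iff.1 hf
  exact (f.continuous.pow 2).integral_pos_of_hasCompactSupport_nonneg_nonzero
    (HasCompactSupport.of_compactSpace _) (fun x => sq_nonneg _) (pow_ne_zero 2 hx)

theorem norm_midpoint_sq_le {E : Type*} [SeminormedAddCommGroup E] [NormedSpace ℝ E] (x y : E) :
    4 * ‖(2⁻¹ : ℝ) • (x + y)‖ ^ 2 ≤ 2 * ‖x‖ ^ 2 + 2 * ‖y‖ ^ 2 := by
  rw [norm_smul, Real.norm_of_nonneg (by norm_num)]
  have h := pow_le_pow_left₀ (norm_nonneg _) (norm_add_le x y) 2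
  nlinarith [sq_nonneg (‖x‖ - ‖y‖)]

/-- If `μ` is a strictly positive finite Borel measure on `K`, then
`|||f||| = sqrt(‖f‖∞² + ∫ f² dμ)` is an equivalent URED norm on `C(K)`. -/
theorem stmt1 {K : Type*} [TopologicalSpace K] [CompactSpace K] [T2Space K]
    [MeasurableSpace K] [BorelSpace K]
    (μ : Measure K) [IsFiniteMeasure μ]
    (hμ : ∀ G : Set K, IsOpen G → G.Nonempty → 0 < μ G) :
    (∃ c : ℝ, 0 < c ∧ ∃ C : ℝ, 0 < C ∧ ∀ f : C(K, ℝ),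
        Real.sqrt (‖f‖ ^ 2 + ∫ x, (f x) ^ 2 ∂μ) ≤ C * ‖f‖ ∧
        ‖f‖ ≤ c * Real.sqrt (‖f‖ ^ 2 + ∫ x, (f x) ^ 2 ∂μ)) ∧
    IsUREDNorm (fun f : C(K, ℝ) => Real.sqrt (‖f‖ ^ 2 + ∫ x, (f x) ^ 2 ∂μ)) := by
  have hQ (f : C(K, ℝ)) : 0 ≤ ∫ x, (f x) ^ 2 ∂μ := integral_nonneg fun x => sq_nonneg _
  have hN (f : C(K, ℝ)) : 0 ≤ ‖f‖ ^ 2 + ∫ x, (f x) ^ 2 ∂μ := add_nonneg (sq_nonneg _) (hQ f)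
  have : μ.IsOpenPosMeasure := ⟨fun U hU hne => (hμ U hU hne).ne'⟩
  refine ⟨⟨1, one_pos, √(1 + μ.real Set.univ), by positivity, fun f => ⟨?_, ?_⟩⟩, ?_⟩
  · refine Real.sqrt_le_iff.2 ⟨by positivity, ?_⟩
    rw [mul_pow, Real.sq_sqrt (by positivity)]
    linarith [integral_sq_continuousMap_le μ f]
  · rw [one_mul]
    exact Real.le_sqrt_of_sq_le (le_add_of_nonneg_right (hQ f))
  · intro x y z r hx hy hmid hxy
    simp only [Real.sqrt_eq_one] at hx hy
    rcases eq_or_ne z 0 with rfl | hz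
    · simp [hxy]
    have hzpos := integral_sq_pos_continuousMap μ hz
    have hmid' := hmid.pow 2
    simp only [Real.sq_sqrt (hN _)] at hmid'
    have hr : Tendsto (fun n => r n ^ 2) atTop (𝓝 0) := by
      have hlim := ((hmid'.const_sub 1).const_mul 4).div_const (∫ t, (z t) ^ 2 ∂μ)
      rw [one_pow, sub_self, mul_zero, zero_div] at hlim
      refine squeeze_zero (fun n => sq_nonneg _) (fun n => ?_) hlim
      have h := integral_sq_midpoint_continuousMap μ (x n) (y n)
      rw [hxy n, integral_sq_smul_continuousMap μ (r n)] at h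
      rw [le_div_iff₀ hzpos]
      linarith [norm_midpoint_sq_le (x n) (y n), hx n, hy n]
    have hfin := (hr.mul_const (‖z‖ ^ 2 + ∫ t, (z t) ^ 2 ∂μ)).sqrt
    rw [zero_mul, Real.sqrt_zero] at hfin
    refine hfin.congr fun n => ?_
    rw [hxy n]
    beta_reduce
    rw [integral_sq_smul_continuousMap, norm_smul, mul_pow, Real.norm_eq_abs, sq_abs,
      mul_add]
end

section
/- A norm ‖·‖ on a real vector space X is URED if and only if the following holds: whenever (u_n) and (v_n) are sequences in X such that lim_n (2‖u_n‖² + 2‖v_n‖² − ‖u_n + v_n‖²) = 0, (u_n) is bounded, and there exist z ∈ X and scalars r_n with u_n − v_n = r_n·z for all n, then lim_n r_n = 0. -/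
open MeasureTheory Filter Topology

/-- A URED norm has a modulus of rotundity in each nonzero direction, on the unit sphere. -/
lemma IsUREDNorm.exists_norm_add_le_of_norm_eq_one {X : Type*} [NormedAddCommGroup X]
    [NormedSpace ℝ X] (h : IsUREDNorm (fun x : X => ‖x‖)) {z : X} (hz : z ≠ 0)
    {ε : ℝ} (hε : 0 < ε) :
    ∃ δ > 0, ∀ (x y : X) (r : ℝ), ‖x‖ = 1 → ‖y‖ = 1 → x - y = r • z → ε ≤ |r| →
      ‖x + y‖ ≤ 2 * (1 - δ) := by
  by_contra! hcon
  choose x y r hx hy hxy hr hlt using fun n : ℕ => hcon (1 / ((n : ℝ) + 1)) (by positivity)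
  have hmid : Tendsto (fun n => ‖(2⁻¹ : ℝ) • (x n + y n)‖) atTop (𝓝 1) := by
    have hlow : Tendsto (fun n : ℕ => 1 - 1 / ((n : ℝ) + 1)) atTop (𝓝 1) := by
      simpa using tendsto_one_div_add_atTop_nhds_zero_nat.const_sub (1 : ℝ)
    refine tendsto_of_tendsto_of_tendsto_of_le_of_le hlow tendsto_const_nhds
      (fun n => ?_) (fun n => ?_)
    · have := hlt n
      simp only [norm_smul, norm_inv, Real.norm_ofNat]
      linarith
    · have := norm_add_le (x n) (y n)
      rw [hx, hy] at this
      simp only [norm_smul, norm_inv, Real.norm_ofNat]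
      linarith
  have hlim : Tendsto (fun n => ‖x n - y n‖) atTop (𝓝 0) := h x y z r hx hy hmid hxy
  have hle : ε * ‖z‖ ≤ 0 := ge_of_tendsto' hlim fun n => by
    rw [hxy, norm_smul, Real.norm_eq_abs]
    exact mul_le_mul_of_nonneg_right (hr n) (norm_nonneg z)
  exact absurd hle (not_le.mpr (mul_pos hε (norm_pos_iff.mpr hz)))

/-- The modulus of rotundity in a direction extends to chords of the unit ball
with one endpoint on the sphere. -/
lemma IsUREDNorm.exists_norm_add_le_of_norm_le_one {X : Type*} [NormedAddCommGroup X]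
    [NormedSpace ℝ X] (h : IsUREDNorm (fun x : X => ‖x‖)) {z : X} (hz : z ≠ 0)
    {ε : ℝ} (hε : 0 < ε) :
    ∃ δ > 0, ∀ (x y : X) (r : ℝ), ‖x‖ = 1 → ‖y‖ ≤ 1 → x - y = r • z → ε ≤ |r| →
      ‖x + y‖ ≤ 2 * (1 - δ) := by
  obtain ⟨δ, hδ, H⟩ := h.exists_norm_add_le_of_norm_eq_one hz hε
  have hz' : 0 < ‖z‖ := norm_pos_iff.mpr hz
  refine ⟨δ * (ε * ‖z‖ / 2), by positivity, fun x y r hx hy hxy hr => ?_⟩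
  have hr0 : 0 < |r| := hε.trans_le hr
  set d : ℝ := |r| * ‖z‖ with hd
  have hd0 : 0 < d := mul_pos hr0 hz'
  have hnorm : ‖x - y‖ = d := by rw [hxy, norm_smul, Real.norm_eq_abs]
  have hd2 : d ≤ 2 := by
    have := norm_sub_le x y
    linarith
  have hT : 1 ≤ 2 / d := by rwa [le_div_iff₀ hd0, one_mul]
  -- Extend the chord from `x` through `y` until it meets the sphere again.
  obtain ⟨s, ⟨hs1, hsT⟩, hs⟩ : ∃ s ∈ Set.Icc 1 (2 / d), ‖x - s • (x - y)‖ = 1 := by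
    refine intermediate_value_Icc (f := fun s : ℝ => ‖x - s • (x - y)‖) hT
      (by fun_prop) ⟨by simpa using hy, ?_⟩
    have h1 := norm_sub_norm_le ((2 / d) • (x - y)) x
    rw [norm_smul, hnorm, Real.norm_of_nonneg (by positivity), div_mul_cancel₀ _ hd0.ne',
      norm_sub_rev, hx] at h1
    change 1 ≤ ‖x - (2 / d) • (x - y)‖
    linarith
  have hs0 : 0 < s := by linarith
  have hmid : ‖x + (x - s • (x - y))‖ ≤ 2 * (1 - δ) := by
    refine H x _ (s * r) hx hs ?_ ?_
    · rw [sub_sub_cancel, hxy, mul_smul]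
    · rw [abs_mul, abs_of_pos hs0]
      nlinarith
  have hinv : ε * ‖z‖ / 2 ≤ s⁻¹ := by
    calc ε * ‖z‖ / 2 ≤ d / 2 := by rw [hd]; gcongr
      _ = (2 / d)⁻¹ := by rw [inv_div]
      _ ≤ s⁻¹ := inv_anti₀ hs0 hsT
  have hs1' : s⁻¹ ≤ 1 := inv_le_one_of_one_le₀ hs1
  have hcomb : x + y = (2 * (1 - s⁻¹)) • x + s⁻¹ • (x + (x - s • (x - y))) := by
    have : s⁻¹ • s • (x - y) = x - y := inv_smul_smul₀ hs0.ne' _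
    rw [smul_add, smul_sub, this]
    module
  calc ‖x + y‖ ≤ ‖(2 * (1 - s⁻¹)) • x‖ + ‖s⁻¹ • (x + (x - s • (x - y)))‖ := by
        conv_lhs => rw [hcomb]
        exact norm_add_le _ _
    _ = 2 * (1 - s⁻¹) + s⁻¹ * ‖x + (x - s • (x - y))‖ := by
        rw [norm_smul, norm_smul, hx, Real.norm_of_nonneg (by linarith),
          Real.norm_of_nonneg (by positivity), mul_one]
    _ ≤ 2 * (1 - s⁻¹) + s⁻¹ * (2 * (1 - δ)) := by gcongr
    _ ≤ 2 * (1 - δ * (ε * ‖z‖ / 2)) := by nlinarith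

/-- If `s ≤ 2 a (1 - δ)` and `0 ≤ s ≤ a + b`, then `2 a² + 2 b² - s²` is bounded below. -/
lemma sq_le_parallelogram_defect {a b s δ : ℝ} (ha : 0 < a) (hs : 0 ≤ s) (hδ : 0 < δ)
    (hsab : s ≤ a + b) (hsa : s ≤ 2 * a * (1 - δ)) :
    (a * δ / 2) ^ 2 ≤ 2 * a ^ 2 + 2 * b ^ 2 - s ^ 2 := by
  have hδ1 : δ ≤ 1 := by
    by_contra! hlt
    nlinarith
  rcases le_total b (a * (1 - δ / 2)) with hba | hba
  · have h1 : s ^ 2 ≤ (a + b) ^ 2 := by gcongr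
    have h2 : (a * δ / 2) ^ 2 ≤ (a - b) ^ 2 := by
      apply pow_le_pow_left₀ (by positivity)
      linarith
    linarith
  · have h1 : s ^ 2 ≤ (2 * a * (1 - δ)) ^ 2 := by gcongr
    have h2 : (a * (1 - δ / 2)) ^ 2 ≤ b ^ 2 :=
      pow_le_pow_left₀ (mul_nonneg ha.le (by linarith)) hba 2
    have h3 : 0 ≤ a ^ 2 * (δ * (1 - δ)) :=
      mul_nonneg (sq_nonneg a) (mul_nonneg hδ.le (by linarith))
    have h4 : 0 ≤ a ^ 2 * δ := by positivity
    nlinarith [mul_nonneg h4 hδ.le]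

/-- For a URED norm, the parallelogram defect of bounded vectors differing by a non-negligible
multiple of a fixed direction is bounded below. -/
lemma IsUREDNorm.exists_le_parallelogram_defect {X : Type*} [NormedAddCommGroup X]
    [NormedSpace ℝ X] (h : IsUREDNorm (fun x : X => ‖x‖)) {z : X} (hz : z ≠ 0)
    {ε B : ℝ} (hε : 0 < ε) (hB : 0 < B) :
    ∃ c > 0, ∀ (u v : X) (r : ℝ), ‖u‖ ≤ B → ‖v‖ ≤ ‖u‖ → u - v = r • z → ε ≤ |r| →
      c ≤ 2 * ‖u‖ ^ 2 + 2 * ‖v‖ ^ 2 - ‖u + v‖ ^ 2 := by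
  obtain ⟨δ, hδ, H⟩ := h.exists_norm_add_le_of_norm_le_one hz (div_pos hε hB)
  have hz' : 0 < ‖z‖ := norm_pos_iff.mpr hz
  refine ⟨(ε * ‖z‖ / 2 * δ / 2) ^ 2, by positivity, fun u v r hu hv huv hr => ?_⟩
  have hlow : ε * ‖z‖ / 2 ≤ ‖u‖ := by
    have h1 := norm_sub_le u v
    rw [huv, norm_smul, Real.norm_eq_abs] at h1
    have h2 : ε * ‖z‖ ≤ |r| * ‖z‖ := by gcongr
    linarith
  have hu0 : 0 < ‖u‖ := lt_of_lt_of_le (by positivity) hlow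
  have hsum : ‖‖u‖⁻¹ • u + ‖u‖⁻¹ • v‖ ≤ 2 * (1 - δ) := by
    refine H _ _ (‖u‖⁻¹ * r) ?_ ?_ ?_ ?_
    · rw [norm_smul, norm_inv, norm_norm, inv_mul_cancel₀ hu0.ne']
    · rw [norm_smul, norm_inv, norm_norm, inv_mul_le_iff₀ hu0, mul_one]
      exact hv
    · rw [← smul_sub, huv, mul_smul]
    · rw [abs_mul, abs_of_pos (inv_pos.mpr hu0), div_eq_inv_mul]
      gcongr
  rw [← smul_add, norm_smul, norm_inv, norm_norm, inv_mul_le_iff₀ hu0] at hsum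
  calc (ε * ‖z‖ / 2 * δ / 2) ^ 2 ≤ (‖u‖ * δ / 2) ^ 2 := by gcongr
    _ ≤ _ := sq_le_parallelogram_defect hu0 (norm_nonneg _) hδ
      (norm_add_le u v) (by linarith)

/-- A norm is URED iff: whenever `2‖u_n‖² + 2‖v_n‖² - ‖u_n + v_n‖² → 0`, `(u_n)` is
bounded, and `u_n - v_n = r_n • z` for a fixed direction `z ≠ 0`, then `r_n → 0`. -/
theorem stmt6 {X : Type*} [NormedAddCommGroup X] [NormedSpace ℝ X] :
    IsUREDNorm (fun x : X => ‖x‖) ↔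
    (∀ (u v : ℕ → X) (z : X) (r : ℕ → ℝ), z ≠ 0 →
      Tendsto (fun n => 2 * ‖u n‖ ^ 2 + 2 * ‖v n‖ ^ 2 - ‖u n + v n‖ ^ 2) atTop (𝓝 0) →
      (∃ C : ℝ, ∀ n, ‖u n‖ ≤ C) →
      (∀ n, u n - v n = r n • z) →
      Tendsto r atTop (𝓝 0)) := by
  constructor
  · rintro h u v z r hz hlim ⟨C, hC⟩ huv
    have hC0 : 0 ≤ C := (norm_nonneg _).trans (hC 0)
    rw [Metric.tendsto_nhds]
    intro ε hε
    obtain ⟨c, hc, H⟩ := h.exists_le_parallelogram_defect hz hε (B := C + 1) (by linarith)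
    filter_upwards [hlim.eventually_lt_const hc, hlim.eventually_lt_const one_pos] with n hn hn1
    rw [Real.dist_eq, sub_zero]
    by_contra! hr
    have hv : ‖v n‖ ≤ C + 1 := by
      have h1 : ‖u n + v n‖ ^ 2 ≤ (‖u n‖ + ‖v n‖) ^ 2 := by
        gcongr
        exact norm_add_le _ _
      have h2 : ‖v n‖ - ‖u n‖ ≤ 1 := by nlinarith
      linarith [hC n]
    rcases le_total ‖v n‖ ‖u n‖ with hle | hle
    · linarith [H (u n) (v n) (r n) (by linarith [hC n]) hle (huv n) hr]
    · have := H (v n) (u n) (-r n) hv hle (by rw [neg_smul, ← huv, neg_sub]) (by rwa [abs_neg])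
      rw [add_comm (v n)] at this
      linarith
  · intro h x y z r hx hy hmid hxy
    rcases eq_or_ne z 0 with rfl | hz
    · simp [hxy]
    · have hr : Tendsto r atTop (𝓝 0) := by
        refine h x y z r hz ?_ ⟨1, fun n => (hx n).le⟩ hxy
        have := ((hmid.pow 2).const_mul 4).const_sub 4
        norm_num at this
        refine this.congr fun n => ?_
        have hxn : ‖x n‖ = 1 := hx n
        have hyn : ‖y n‖ = 1 := hy n
        rw [← smul_add, norm_smul, hxn, hyn]
        norm_num
        ring
      simp only [hxy, norm_smul]
      simpa using hr.norm.mul_const ‖z‖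
end

section
/- Let X be a real normed space whose norm is URED and let t > 0. Then X = ⋃_{i≥1} U_i(t); that is, for every x ∈ X there exists a positive integer i such that ‖x + y‖² + ‖x − y‖² ≥ (1 + 1/i)·2‖y‖² for every y ∈ X with 0 < ‖y‖ ≤ t‖x‖. -/
open MeasureTheory Filter Topology

/-- The set `U_i(t)` of vectors `x` such that
`‖x + y‖² + ‖x - y‖² ≥ (1 + 1/i)·2‖y‖²` whenever `‖y‖ ≤ t‖x‖`. -/
def UredBall (X : Type*) [NormedAddCommGroup X] (t : ℝ) (i : ℕ) : Set X :=
  {x | ∀ y : X, ‖y‖ ≤ t * ‖x‖ →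
    (1 + (i : ℝ)⁻¹) * (2 * ‖y‖ ^ 2) ≤ ‖x + y‖ ^ 2 + ‖x - y‖ ^ 2}

/-- If `‖y - x‖ ≤ ‖y + x‖`, the line `y + ℝ x` meets the sphere of radius `‖x + y‖` again at or
beyond `y - x`. -/
lemma exists_le_neg_one_norm_add_smul_eq {X : Type*} [NormedAddCommGroup X] [NormedSpace ℝ X]
    {x y : X} (hx : x ≠ 0) (h : ‖x - y‖ ≤ ‖x + y‖) :
    ∃ s : ℝ, s ≤ -1 ∧ ‖y + s • x‖ = ‖x + y‖ := by
  have hx0 : 0 < ‖x‖ := norm_pos_iff.mpr hx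
  set S : ℝ := 1 + (‖x + y‖ + ‖y‖) / ‖x‖ with hS
  have hS1 : 1 ≤ S := le_add_of_nonneg_right (by positivity)
  have hend : ‖x + y‖ ≤ ‖y + (-S) • x‖ := by
    have h1 : ‖S • x‖ ≤ ‖y + (-S) • x‖ + ‖y‖ := by
      have := norm_sub_le y (y + (-S) • x)
      rw [show y - (y + (-S) • x) = S • x by module] at this
      linarith
    rw [norm_smul, Real.norm_of_nonneg (by linarith)] at h1
    have h2 : S * ‖x‖ = ‖x‖ + (‖x + y‖ + ‖y‖) := by
      rw [hS]; field_simp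
    linarith
  have hstart : ‖y + (-1 : ℝ) • x‖ ≤ ‖x + y‖ := by
    rwa [show y + (-1 : ℝ) • x = -(x - y) by module, norm_neg]
  have hcont : ContinuousOn (fun s : ℝ => ‖y + s • x‖) (Set.Icc (-S) (-1)) := by fun_prop
  obtain ⟨s, hs, hs'⟩ := intermediate_value_Icc' (by linarith) hcont ⟨hstart, hend⟩
  exact ⟨s, hs.2, hs'⟩

/-- A chord of the unit sphere in direction `x` whose length and midpoint are controlled by
`‖x + y‖` and `‖y‖`. -/
lemma exists_unit_chord {X : Type*} [NormedAddCommGroup X] [NormedSpace ℝ X]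
    {x y : X} (hx : x ≠ 0) (h : ‖x - y‖ ≤ ‖x + y‖) :
    ∃ (u v : X) (r : ℝ), ‖u‖ = 1 ∧ ‖v‖ = 1 ∧ u - v = r • x ∧
      2 * ‖x‖ ≤ ‖u - v‖ * ‖x + y‖ ∧
      (1 - ‖(2⁻¹ : ℝ) • (u + v)‖) * ‖x‖ ≤ ‖x + y‖ - ‖y‖ := by
  have hx0 : 0 < ‖x‖ := norm_pos_iff.mpr hx
  obtain ⟨s, hs1, hs⟩ := exists_le_neg_one_norm_add_smul_eq hx h
  have hxM : ‖x‖ ≤ ‖x + y‖ := by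
    have := norm_add_le (x + y) (x - y)
    rw [show x + y + (x - y) = (2 : ℝ) • x by module, norm_smul, Real.norm_ofNat] at this
    linarith
  set M := ‖x + y‖ with hM
  have hM0 : 0 < M := hx0.trans_le hxM
  have hinv : ‖M⁻¹‖ = M⁻¹ := Real.norm_of_nonneg (by positivity)
  have hlen : ‖(1 - s) • x‖ = (1 - s) * ‖x‖ := by
    rw [norm_smul, Real.norm_of_nonneg (by linarith)]
  have hle : (1 - s) * ‖x‖ ≤ 2 * M := by
    have := norm_sub_le (x + y) (y + s • x)
    rw [show x + y - (y + s • x) = (1 - s) • x by module, hlen] at this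
    linarith
  refine ⟨M⁻¹ • (x + y), M⁻¹ • (y + s • x), M⁻¹ * (1 - s), ?_, ?_, by module, ?_, ?_⟩
  · rw [norm_smul, hinv, ← hM, inv_mul_cancel₀ hM0.ne']
  · rw [norm_smul, hinv, hs, inv_mul_cancel₀ hM0.ne']
  · rw [show M⁻¹ • (x + y) - M⁻¹ • (y + s • x) = M⁻¹ • ((1 - s) • x) by module, norm_smul, hinv,
      hlen, mul_right_comm, inv_mul_cancel₀ hM0.ne', one_mul]
    nlinarith
  · rw [show (2⁻¹ : ℝ) • (M⁻¹ • (x + y) + M⁻¹ • (y + s • x))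
      = M⁻¹ • (y + ((1 + s) / 2) • x) by module, norm_smul, hinv]
    set m := ‖y + ((1 + s) / 2) • x‖ with hm
    have hmM : m ≤ M := by
      have := norm_add_le (x + y) (y + s • x)
      rw [show x + y + (y + s • x) = (2 : ℝ) • (y + ((1 + s) / 2) • x) by module, norm_smul,
        Real.norm_ofNat] at this
      linarith
    have hconv : (1 - s) * ‖y‖ ≤ 2 * m + (-1 - s) * M := by
      have := norm_add_le ((2 : ℝ) • (y + ((1 + s) / 2) • x)) ((-1 - s) • (x + y))
      rw [show (2 : ℝ) • (y + ((1 + s) / 2) • x) + (-1 - s) • (x + y) = (1 - s) • y by module,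
        norm_smul, norm_smul, norm_smul, Real.norm_of_nonneg (by linarith : 0 ≤ 1 - s),
        Real.norm_of_nonneg (by linarith : 0 ≤ -1 - s), Real.norm_ofNat] at this
      exact this
    have hyM : ‖y‖ ≤ M := by nlinarith
    have key : (M - m) * ‖x‖ ≤ M * (M - ‖y‖) := by
      have h1 : 2 * (M - m) ≤ (1 - s) * (M - ‖y‖) := by linarith
      nlinarith [mul_le_mul_of_nonneg_right h1 hx0.le,
        mul_le_mul_of_nonneg_right hle (sub_nonneg.mpr hyM)]
    rw [show (1 - M⁻¹ * m) * ‖x‖ = M⁻¹ * ((M - m) * ‖x‖) by field_simp,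
      inv_mul_le_iff₀ hM0]
    exact key

/-- A failure of the inequality defining `UredBall X t i` gives a long chord of the unit sphere
whose midpoint is close to the sphere. -/
lemma exists_unit_chord_of_lt {X : Type*} [NormedAddCommGroup X] [NormedSpace ℝ X]
    {x y : X} {t c : ℝ} (ht : 0 < t) (hc : 0 ≤ c) (hx : x ≠ 0) (hy : ‖y‖ ≤ t * ‖x‖)
    (hlt : ‖x + y‖ ^ 2 + ‖x - y‖ ^ 2 < (1 + c) * (2 * ‖y‖ ^ 2)) :
    ∃ (u v : X) (r : ℝ), ‖u‖ = 1 ∧ ‖v‖ = 1 ∧ u - v = r • x ∧ 2 / (1 + t) ≤ ‖u - v‖ ∧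
      (1 - ‖(2⁻¹ : ℝ) • (u + v)‖) ^ 2 ≤ 2 * t ^ 2 * c := by
  wlog h : ‖x - y‖ ≤ ‖x + y‖ generalizing y
  · refine this (y := -y) (by rwa [norm_neg]) ?_ ?_
    · rwa [norm_neg, sub_neg_eq_add, ← sub_eq_add_neg, add_comm]
    · rw [sub_neg_eq_add, ← sub_eq_add_neg]
      exact (not_le.mp h).le
  have hx0 : 0 < ‖x‖ := norm_pos_iff.mpr hx
  obtain ⟨u, v, r, hu, hv, huv, hlen, hmid⟩ := exists_unit_chord hx h
  refine ⟨u, v, r, hu, hv, huv, ?_, ?_⟩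
  · have hM : ‖x + y‖ ≤ (1 + t) * ‖x‖ := by linarith [norm_add_le x y]
    rw [div_le_iff₀ (by linarith)]
    have := hlen.trans (mul_le_mul_of_nonneg_left hM (norm_nonneg (u - v)))
    rw [← mul_assoc] at this
    exact le_of_mul_le_mul_right this hx0
  · have h2y : 2 * ‖y‖ ≤ ‖x + y‖ + ‖x - y‖ := by
      have := norm_sub_le (x + y) (x - y)
      rwa [show x + y - (x - y) = (2 : ℝ) • y by module, norm_smul, Real.norm_ofNat] at this
    have hmid0 : 0 ≤ 1 - ‖(2⁻¹ : ℝ) • (u + v)‖ := by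
      rw [norm_smul, Real.norm_of_nonneg (by norm_num)]
      linarith [norm_add_le u v]
    have hsq : (‖x + y‖ - ‖y‖) ^ 2 ≤ 2 * c * ‖y‖ ^ 2 := by
      have hcy : 0 ≤ c * ‖y‖ ^ 2 := by positivity
      rcases le_total ‖x + y‖ (2 * ‖y‖) with hM | hM
      · nlinarith [norm_nonneg (x - y)]
      · nlinarith [norm_nonneg (x - y), norm_nonneg y]
    have hy2 : ‖y‖ ^ 2 ≤ (t * ‖x‖) ^ 2 := by gcongr
    have hle : ((1 - ‖(2⁻¹ : ℝ) • (u + v)‖) * ‖x‖) ^ 2 ≤ 2 * t ^ 2 * c * ‖x‖ ^ 2 :=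
      calc _ ≤ (‖x + y‖ - ‖y‖) ^ 2 := by gcongr
        _ ≤ 2 * c * ‖y‖ ^ 2 := hsq
        _ ≤ 2 * c * (t * ‖x‖) ^ 2 := by gcongr
        _ = _ := by ring
    rw [mul_pow] at hle
    exact le_of_mul_le_mul_right hle (by positivity)

/-- If the norm of `X` is URED and `t > 0`, then `X = ⋃_{i ≥ 1} U_i(t)`. -/
theorem stmt7 {X : Type*} [NormedAddCommGroup X] [NormedSpace ℝ X]
    (hURED : IsUREDNorm (fun x : X => ‖x‖)) (t : ℝ) (ht : 0 < t) (x : X) :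
    ∃ i : ℕ, 1 ≤ i ∧ x ∈ UredBall X t i := by
  rcases eq_or_ne x 0 with rfl | hx
  · refine ⟨1, le_rfl, fun y hy => ?_⟩
    obtain rfl : y = 0 := by simpa using hy
    simp
  by_contra! hcon
  have hchord (n : ℕ) : ∃ (u v : X) (r : ℝ), ‖u‖ = 1 ∧ ‖v‖ = 1 ∧ u - v = r • x ∧
      2 / (1 + t) ≤ ‖u - v‖ ∧
      (1 - ‖(2⁻¹ : ℝ) • (u + v)‖) ^ 2 ≤ 2 * t ^ 2 * ((n + 1 : ℕ) : ℝ)⁻¹ := by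
    have hn := hcon (n + 1) (Nat.le_add_left 1 n)
    simp only [UredBall, Set.mem_ofPred_eq, not_forall, not_le] at hn
    obtain ⟨y, hy, hlt⟩ := hn
    exact exists_unit_chord_of_lt ht (by positivity) hx hy hlt
  choose u v r hu hv huv hlen hmid using hchord
  have hsq : Tendsto (fun n => (1 - ‖(2⁻¹ : ℝ) • (u n + v n)‖) ^ 2) atTop (𝓝 0) := by
    refine squeeze_zero (fun n => sq_nonneg _) hmid ?_
    simpa using ((tendsto_inv_atTop_nhds_zero_nat (𝕜 := ℝ)).comp
      (tendsto_add_atTop_nat 1)).const_mul (2 * t ^ 2)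
  have hdist : Tendsto (fun n => 1 - ‖(2⁻¹ : ℝ) • (u n + v n)‖) atTop (𝓝 0) := by
    rw [tendsto_zero_iff_abs_tendsto_zero]
    simpa [Function.comp_def, Real.sqrt_sq_eq_abs] using hsq.sqrt
  have hone : Tendsto (fun n => ‖(2⁻¹ : ℝ) • (u n + v n)‖) atTop (𝓝 1) := by
    simpa only [sub_sub_cancel, sub_zero] using hdist.const_sub 1
  have hle := ge_of_tendsto' (hURED u v x r hu hv hone huv) hlen
  have hpos : 0 < 2 / (1 + t) := by positivity
  exact hpos.not_ge hle
end

section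
/- Let X be a real normed space, t > 0, i ≥ 1 an integer, and let f, g be simple X-valued random variables on a probability space (Ω, Σ, p). If E‖f‖² ≤ 1 and ∫_{g^{-1}(U_i(t))} ‖g‖² dp ≥ 2t^{-2}, then E(‖f + g‖² + ‖f − g‖²) ≥ 2·E‖f‖² + t^{-2}·i^{-1}. -/
open MeasureTheory Filter Topology

/-- A simple random variable: finitely many values, each attained on a measurable set. -/
def IsSimpleRV {Ω X : Type*} [MeasurableSpace Ω] (f : Ω → X) : Prop :=
  (Set.range f).Finite ∧ ∀ x : X, MeasurableSet (f ⁻¹' {x})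

/-- Any real function of two simple random variables is integrable for a finite measure. -/
lemma IsSimpleRV.integrable_comp₂ {Ω X : Type*} [MeasurableSpace Ω] {p : Measure Ω}
    [IsFiniteMeasure p] {f g : Ω → X} (hf : IsSimpleRV f) (hg : IsSimpleRV g) (φ : X → X → ℝ) :
    Integrable (fun ω => φ (f ω) (g ω)) p :=
  let F : SimpleFunc Ω X := ⟨f, hf.2, hf.1⟩
  let G : SimpleFunc Ω X := ⟨g, hg.2, hg.1⟩
  SimpleFunc.integrable_of_isFiniteMeasure ((F.pair G).map (Function.uncurry φ))

lemma IsSimpleRV.measurableSet_preimage {Ω X : Type*} [MeasurableSpace Ω] {f : Ω → X}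
    (hf : IsSimpleRV f) (s : Set X) : MeasurableSet (f ⁻¹' s) :=
  SimpleFunc.measurableSet_preimage ⟨f, hf.2, hf.1⟩ s

lemma two_mul_norm_sq_le_norm_add_sq_add_norm_sub_sq {X : Type*} [NormedAddCommGroup X]
    [NormedSpace ℝ X] (x y : X) : 2 * ‖x‖ ^ 2 ≤ ‖x + y‖ ^ 2 + ‖x - y‖ ^ 2 := by
  have h : 2 * ‖x‖ ≤ ‖x + y‖ + ‖x - y‖ := by
    have h1 := norm_add_le (x + y) (x - y)
    rwa [show x + y + (x - y) = (2 : ℝ) • x by rw [two_smul]; abel, norm_smul,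
      Real.norm_two] at h1
  nlinarith [sq_nonneg (‖x + y‖ - ‖x - y‖), norm_nonneg x]

lemma UredBall.norm_sq_sub_le {X : Type*} [NormedAddCommGroup X] [NormedSpace ℝ X]
    {t : ℝ} (ht : 0 < t) {i : ℕ} (hi : 1 ≤ i) (x : X) {y : X} (hy : y ∈ UredBall X t i) :
    (i : ℝ)⁻¹ * (‖y‖ ^ 2 - (t ^ 2)⁻¹ * ‖x‖ ^ 2) ≤
      ‖x + y‖ ^ 2 + ‖x - y‖ ^ 2 - 2 * ‖x‖ ^ 2 := by
  have hx := two_mul_norm_sq_le_norm_add_sq_add_norm_sub_sq x y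
  have hi0 : 0 < (i : ℝ)⁻¹ := by positivity
  rcases le_or_gt ‖x‖ (t * ‖y‖) with h | h
  · have hxy := hy x h
    have hyx := two_mul_norm_sq_le_norm_add_sq_add_norm_sub_sq y x
    rw [add_comm y x, norm_sub_rev y x] at hxy hyx
    set c := (i : ℝ)⁻¹
    have hc : c ≤ 1 := inv_le_one_of_one_le₀ (by exact_mod_cast hi)
    set S := ‖x + y‖ ^ 2 + ‖x - y‖ ^ 2
    have h1 : 2 * c * ‖y‖ ^ 2 ≤ (1 + c) * (S - 2 * ‖x‖ ^ 2) := by nlinarith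
    have h2 : (1 + c) * (S - 2 * ‖x‖ ^ 2) ≤ 2 * (S - 2 * ‖x‖ ^ 2) :=
      mul_le_mul_of_nonneg_right (by linarith) (by linarith)
    have h3 : 0 ≤ c * ((t ^ 2)⁻¹ * ‖x‖ ^ 2) := by positivity
    linarith
  · have h1 : ‖y‖ ^ 2 ≤ (t ^ 2)⁻¹ * ‖x‖ ^ 2 := by
      rw [le_inv_mul_iff₀ (by positivity), ← mul_pow]
      gcongr
    nlinarith [mul_nonneg hi0.le (sub_nonneg.2 h1)]

/-- If `E‖f‖² ≤ 1` and `∫_{g⁻¹(U_i(t))} ‖g‖² dp ≥ 2t⁻²`, then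
`E(‖f + g‖² + ‖f - g‖²) ≥ 2E‖f‖² + t⁻²i⁻¹`. -/
theorem stmt8 {X : Type*} [NormedAddCommGroup X] [NormedSpace ℝ X]
    {Ω : Type*} [MeasurableSpace Ω] (p : Measure Ω) [IsProbabilityMeasure p]
    (t : ℝ) (ht : 0 < t) (i : ℕ) (hi : 1 ≤ i)
    (f g : Ω → X) (hf : IsSimpleRV f) (hg : IsSimpleRV g)
    (hf2 : ∫ ω, ‖f ω‖ ^ 2 ∂p ≤ 1)
    (hg2 : 2 * (t ^ 2)⁻¹ ≤ ∫ ω in g ⁻¹' (UredBall X t i), ‖g ω‖ ^ 2 ∂p) :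
    2 * (∫ ω, ‖f ω‖ ^ 2 ∂p) + (t ^ 2)⁻¹ * (i : ℝ)⁻¹ ≤
      ∫ ω, (‖f ω + g ω‖ ^ 2 + ‖f ω - g ω‖ ^ 2) ∂p := by
  have hA := hg.measurableSet_preimage (UredBall X t i)
  have hF : Integrable (fun ω => ‖f ω‖ ^ 2) p := hf.integrable_comp₂ hg fun x _ => ‖x‖ ^ 2
  have hG : Integrable ((g ⁻¹' UredBall X t i).indicator fun ω => ‖g ω‖ ^ 2) p :=
    (hf.integrable_comp₂ hg fun _ y => ‖y‖ ^ 2).indicator hA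
  have hS : Integrable (fun ω => ‖f ω + g ω‖ ^ 2 + ‖f ω - g ω‖ ^ 2) p :=
    hf.integrable_comp₂ hg fun x y => ‖x + y‖ ^ 2 + ‖x - y‖ ^ 2
  have key : ∫ ω, (i : ℝ)⁻¹ * ((g ⁻¹' UredBall X t i).indicator (fun ω => ‖g ω‖ ^ 2) ω -
      (t ^ 2)⁻¹ * ‖f ω‖ ^ 2) ∂p ≤
      ∫ ω, (‖f ω + g ω‖ ^ 2 + ‖f ω - g ω‖ ^ 2 - 2 * ‖f ω‖ ^ 2) ∂p := by
    refine integral_mono ((hG.sub (hF.const_mul _)).const_mul _) (hS.sub (hF.const_mul _))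
      fun ω => ?_
    by_cases h : ω ∈ g ⁻¹' UredBall X t i
    · simpa only [Set.indicator_of_mem h] using UredBall.norm_sq_sub_le ht hi (f ω) h
    · have h1 := two_mul_norm_sq_le_norm_add_sq_add_norm_sub_sq (f ω) (g ω)
      have h2 : 0 ≤ (i : ℝ)⁻¹ * ((t ^ 2)⁻¹ * ‖f ω‖ ^ 2) := by positivity
      simp only [Set.indicator_of_notMem h]
      linarith
  rw [integral_const_mul, integral_sub hG (hF.const_mul _), integral_const_mul,
    integral_indicator hA, integral_sub hS (hF.const_mul _), integral_const_mul] at key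
  have h1 : (t ^ 2)⁻¹ * ∫ ω, ‖f ω‖ ^ 2 ∂p ≤ (t ^ 2)⁻¹ :=
    mul_le_of_le_one_right (by positivity) hf2
  have h2 : (i : ℝ)⁻¹ * (t ^ 2)⁻¹ ≤ (i : ℝ)⁻¹ *
      ((∫ ω in g ⁻¹' UredBall X t i, ‖g ω‖ ^ 2 ∂p) - (t ^ 2)⁻¹ * ∫ ω, ‖f ω‖ ^ 2 ∂p) :=
    mul_le_mul_of_nonneg_left (by linarith) (by positivity)
  linarith
end

section
/- Let X be a real normed space, t > 0, i ≥ 1 an integer, and let (M_n) be a discrete martingale with values in X over a martingale setup such that sup_n E‖M_n‖² ≤ 1. Fix n ≥ 1 such that ∫_{(dM_n)^{-1}(U_i(t)) ∩ Ω_n} ‖dM_n‖² dp ≥ 2t^{-2}. Then E‖M_n‖² ≥ E‖M_{n−1}‖² + t^{-2}·i^{-1}. -/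
open MeasureTheory Filter Topology

/-- A martingale setup: a sequence of finite measurable partitions of `Ω`, each refining
the previous one. -/
structure MartingaleSetup (Ω : Type*) [MeasurableSpace Ω] (p : Measure Ω) where
  part : ℕ → Finset (Set Ω)
  meas : ∀ n, ∀ E ∈ part n, MeasurableSet E
  disj : ∀ n, (↑(part n) : Set (Set Ω)).PairwiseDisjoint id
  cover : ∀ n, ⋃₀ (↑(part n) : Set (Set Ω)) = Set.univ
  refines : ∀ n, ∀ E ∈ part (n + 1), ∃ F ∈ part n, E ⊆ F

namespace MartingaleSetup

variable {Ω : Type*} [MeasurableSpace Ω] {p : Measure Ω}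

/-- Membership in the algebra `𝒜_n` generated by the `n`-th partition. -/
def MemAlg (S : MartingaleSetup Ω p) (n : ℕ) (E : Set Ω) : Prop :=
  ∃ T : Finset (Set Ω), T ⊆ S.part n ∧ E = ⋃₀ (↑T : Set (Set Ω))

/-- `Ω_k`: the union of all `k`-Walsh-Paley pairs, i.e. pairs `E₁, E₂ ∈ ℰ_k` with
`p E₁ = p E₂` and `E₁ ∪ E₂ ∈ ℰ_{k-1}`. -/
def wpUnion (S : MartingaleSetup Ω p) (k : ℕ) : Set Ω :=
  ⋃₀ {E | ∃ E₁ E₂ : Set Ω, E₁ ∈ S.part k ∧ E₂ ∈ S.part k ∧ p E₁ = p E₂ ∧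
      E₁ ∪ E₂ ∈ S.part (k - 1) ∧ (E = E₁ ∨ E = E₂)}

end MartingaleSetup

/-- A discrete martingale adapted to a martingale setup: each `M n` is constant on every
element of the `n`-th partition, and the increment `dM n = M n - M (n-1)` has zero integral
on every element of the algebra generated by the `(n-1)`-st partition (stated through
continuous linear functionals, so that it makes sense in any normed space). -/
def IsSimpleMartingale {Ω X : Type*} [MeasurableSpace Ω] {p : Measure Ω}
    [NormedAddCommGroup X] [NormedSpace ℝ X]
    (S : MartingaleSetup Ω p) (M : ℕ → Ω → X) : Prop :=
  (∀ n, ∀ E ∈ S.part n, ∀ ω ∈ E, ∀ ω' ∈ E, M n ω = M n ω') ∧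
  (∀ n, 1 ≤ n → ∀ E : Set Ω, S.MemAlg (n - 1) E → ∀ φ : X →L[ℝ] ℝ,
    ∫ ω in E, φ (M n ω - M (n - 1) ω) ∂p = 0)

theorem two_mul_norm_sq_le {X : Type*} [NormedAddCommGroup X] [NormedSpace ℝ X] (x y : X) :
    2 * ‖y‖ ^ 2 ≤ ‖x + y‖ ^ 2 + ‖x - y‖ ^ 2 := by
  have h : 2 * ‖y‖ ≤ ‖x + y‖ + ‖x - y‖ := by
    have h1 := norm_sub_le (x + y) (x - y)
    have h2 : (x + y) - (x - y) = (2 : ℝ) • y := by rw [two_smul]; abel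
    rwa [h2, norm_smul, Real.norm_two] at h1
  nlinarith [sq_nonneg (‖x + y‖ - ‖x - y‖), norm_nonneg y]

theorem UredBall.neg_mem {X : Type*} [NormedAddCommGroup X] {t : ℝ} {i : ℕ} {x : X}
    (hx : x ∈ UredBall X t i) : -x ∈ UredBall X t i := by
  intro y hy
  rw [norm_neg] at hy
  have h := hx y hy
  rw [← norm_neg (-x + y), ← norm_neg (-x - y), neg_add, neg_sub, neg_neg, ← sub_eq_add_neg,
    sub_neg_eq_add, add_comm y x]
  linarith

/-- Testing membership in `U_i(t)` on multiples of `x` itself forces `t² ≤ i`. -/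
theorem UredBall.sq_mul_inv_le_one {X : Type*} [NormedAddCommGroup X] [NormedSpace ℝ X]
    {t : ℝ} (ht : 0 < t) {i : ℕ} {x : X} (hx : x ∈ UredBall X t i) (hx0 : x ≠ 0) :
    t ^ 2 * (i : ℝ)⁻¹ ≤ 1 := by
  have h := hx (t • x) (by rw [norm_smul, Real.norm_of_nonneg ht.le])
  have h1 : x + t • x = (1 + t) • x := by rw [add_smul, one_smul]
  have h2 : x - t • x = (1 - t) • x := by rw [sub_smul, one_smul]
  rw [h1, h2, norm_smul, norm_smul, norm_smul, mul_pow, mul_pow, mul_pow, Real.norm_eq_abs,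
    Real.norm_eq_abs, Real.norm_eq_abs, sq_abs, sq_abs, sq_abs] at h
  have hpos : 0 < ‖x‖ ^ 2 := by positivity
  by_contra! hlt
  nlinarith [mul_lt_mul_of_pos_right hlt hpos]

/-- A vector of `U_i(t)` yields a quantitative gain in the midpoint convexity of `‖·‖²`. -/
theorem UredBall.norm_sq_gain {X : Type*} [NormedAddCommGroup X] [NormedSpace ℝ X]
    {t : ℝ} (ht : 0 < t) {i : ℕ} (hi : 1 ≤ i) {x : X} (hx : x ∈ UredBall X t i) (y : X) :
    2 * (‖y‖ ^ 2 + (i : ℝ)⁻¹ * (‖x‖ ^ 2 - (t ^ 2)⁻¹ * ‖y‖ ^ 2)) ≤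
      ‖y + x‖ ^ 2 + ‖y - x‖ ^ 2 := by
  have hi0 : (0 : ℝ) < (i : ℝ)⁻¹ := by positivity
  have hi1 : (i : ℝ)⁻¹ ≤ 1 := inv_le_one_of_one_le₀ (by exact_mod_cast hi)
  have hconv := two_mul_norm_sq_le x y
  rw [add_comm y x, norm_sub_rev y x]
  rcases le_or_gt ‖y‖ (t * ‖x‖) with hy | hy
  · have hU := hx y hy
    have hconv' := two_mul_norm_sq_le y x
    rw [add_comm y x, norm_sub_rev y x] at hconv'
    rcases eq_or_ne x 0 with rfl | hx0
    · have : y = 0 := by simpa using hy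
      simp [this]
    · have hit : (i : ℝ)⁻¹ ≤ (t ^ 2)⁻¹ := by
        have := UredBall.sq_mul_inv_le_one ht hx hx0
        rw [← one_div (t ^ 2), le_div_iff₀ (by positivity)]
        linarith
      have h1 := mul_le_mul_of_nonneg_left hconv' hi0.le
      have h2 := mul_le_mul_of_nonneg_left hU (sub_nonneg.2 hi1)
      have h3 := mul_le_mul_of_nonneg_left
        (mul_le_mul_of_nonneg_right hit (sq_nonneg ‖y‖)) hi0.le
      nlinarith
  · have h1 : ‖x‖ ^ 2 - (t ^ 2)⁻¹ * ‖y‖ ^ 2 ≤ 0 := by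
      have h2 : (t * ‖x‖) ^ 2 ≤ ‖y‖ ^ 2 := by gcongr
      have h3 := mul_le_mul_of_nonneg_left h2 (inv_nonneg.2 (sq_nonneg t))
      rw [mul_pow, inv_mul_cancel_left₀ (by positivity)] at h3
      linarith
    nlinarith [mul_nonpos_of_nonneg_of_nonpos hi0.le h1]

theorem eq_zero_of_forall_dual {X : Type*} [NormedAddCommGroup X] [NormedSpace ℝ X] {x : X}
    (h : ∀ φ : X →L[ℝ] ℝ, φ x = 0) : x = 0 := by
  obtain ⟨φ, -, hφ⟩ := exists_dual_vector'' ℝ x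
  rw [h φ] at hφ
  simpa using hφ.symm

namespace MartingaleSetup

variable {Ω : Type*} [MeasurableSpace Ω] {p : Measure Ω}

/-- `f` is constant on every element of the `n`-th partition. -/
def ConstOn {β : Type*} (S : MartingaleSetup Ω p) (n : ℕ) (f : Ω → β) : Prop :=
  ∀ E ∈ S.part n, ∀ ω ∈ E, ∀ ω' ∈ E, f ω = f ω'

theorem ConstOn.succ {β : Type*} {S : MartingaleSetup Ω p} {n : ℕ} {f : Ω → β}
    (hf : S.ConstOn n f) : S.ConstOn (n + 1) f := by
  intro E hE ω hω ω' hω'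
  obtain ⟨F, hF, hEF⟩ := S.refines n E hE
  exact hf F hF ω (hEF hω) ω' (hEF hω')

theorem iUnion_part (S : MartingaleSetup Ω p) (n : ℕ) : ⋃ E ∈ S.part n, E = Set.univ := by
  rw [← S.cover n, Set.sUnion_eq_biUnion]
  rfl

theorem ConstOn.integrable {S : MartingaleSetup Ω p} {n : ℕ} {f : Ω → ℝ}
    (hf : S.ConstOn n f) (ν : Measure Ω) [IsFiniteMeasure ν] : Integrable f ν := by
  rw [← integrableOn_univ, ← S.iUnion_part n, integrableOn_finset_iUnion]
  intro E hE
  rcases E.eq_empty_or_nonempty with rfl | ⟨ω, hω⟩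
  · exact integrableOn_empty
  · exact (integrableOn_const (C := f ω) (measure_ne_top ν E)).congr_fun
      (fun ω' hω' => hf E hE ω hω ω' hω') (S.meas n E hE)

theorem integral_eq_sum_part (S : MartingaleSetup Ω p) (n : ℕ) {f : Ω → ℝ} {ν : Measure Ω}
    (hf : Integrable f ν) : ∫ ω, f ω ∂ν = ∑ E ∈ S.part n, ∫ ω in E, f ω ∂ν := by
  rw [← setIntegral_univ, ← S.iUnion_part n]
  exact integral_biUnion_finset _ (S.meas n) (S.disj n) (fun E _ => hf.integrableOn)

theorem memAlg_of_mem_part {S : MartingaleSetup Ω p} {n : ℕ} {A : Set Ω} (hA : A ∈ S.part n) :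
    S.MemAlg n A :=
  ⟨{A}, by simpa using hA, by simp⟩

end MartingaleSetup

section Increment

variable {Ω X : Type*} [MeasurableSpace Ω] {p : Measure Ω}
  [NormedAddCommGroup X] [NormedSpace ℝ X] {S : MartingaleSetup Ω p} {M : ℕ → Ω → X}

theorem IsSimpleMartingale.constOn_increment (hM : IsSimpleMartingale S M) (n : ℕ) :
    S.ConstOn (n + 1) (fun ω => M (n + 1) ω - M n ω) := by
  intro E hE ω hω ω' hω'
  change M (n + 1) ω - M n ω = M (n + 1) ω' - M n ω'
  rw [hM.1 (n + 1) E hE ω hω ω' hω', MartingaleSetup.ConstOn.succ (hM.1 n) E hE ω hω ω' hω']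

variable [IsProbabilityMeasure p]

theorem IsSimpleMartingale.integral_norm_sq_le (hM : IsSimpleMartingale S M) {n : ℕ}
    {A : Set Ω} (hA : A ∈ S.part n) :
    ∫ ω in A, ‖M n ω‖ ^ 2 ∂p ≤ ∫ ω in A, ‖M (n + 1) ω‖ ^ 2 ∂p := by
  rcases A.eq_empty_or_nonempty with rfl | ⟨a, ha⟩
  · simp
  obtain ⟨φ, hφ, hφy⟩ := exists_dual_vector'' ℝ (M n a)
  simp only [RCLike.ofReal_real_eq_id, id] at hφy
  have hd := hM.constOn_increment n
  have hdi : Integrable (fun ω => φ (M (n + 1) ω - M n ω)) (p.restrict A) :=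
    MartingaleSetup.ConstOn.integrable (S := S) (n := n + 1)
      (fun E hE ω hω ω' hω' => congrArg φ (hd E hE ω hω ω' hω')) _
  have hsq : ∀ m, Integrable (fun ω => ‖M m ω‖ ^ 2) (p.restrict A) := fun m =>
    MartingaleSetup.ConstOn.integrable (S := S) (n := m)
      (fun E hE ω hω ω' hω' => by simp only [hM.1 m E hE ω hω ω' hω']) _
  have hzero := hM.2 (n + 1) (by omega) A (MartingaleSetup.memAlg_of_mem_part hA) φ
  simp only [Nat.add_sub_cancel] at hzero
  calc ∫ ω in A, ‖M n ω‖ ^ 2 ∂p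
      = ∫ ω in A, (‖M n ω‖ ^ 2 + 2 * ‖M n a‖ * φ (M (n + 1) ω - M n ω)) ∂p := by
        rw [integral_add (hsq n) (hdi.const_mul _), integral_const_mul, hzero, mul_zero,
          add_zero]
    _ ≤ ∫ ω in A, ‖M (n + 1) ω‖ ^ 2 ∂p := by
        refine setIntegral_mono_on ((hsq n).add (hdi.const_mul _)) (hsq (n + 1))
          (S.meas n A hA) fun ω hω => ?_
        rw [hM.1 n A hA ω hω a ha, map_sub, hφy]
        have h1 : |φ (M (n + 1) ω)| ≤ ‖M (n + 1) ω‖ := by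
          simpa using φ.le_of_opNorm_le hφ (M (n + 1) ω)
        have h2 := sq_le_sq' (abs_le.1 h1).1 (abs_le.1 h1).2
        nlinarith [sq_nonneg (φ (M (n + 1) ω) - ‖M n a‖)]

/-- On a Walsh-Paley pair `E, F`, the increment takes opposite values on the two halves. -/
theorem IsSimpleMartingale.increment_add_eq_zero (hM : IsSimpleMartingale S M) {n : ℕ}
    {E F : Set Ω} (hE : E ∈ S.part (n + 1)) (hF : F ∈ S.part (n + 1)) (hEF : Disjoint E F)
    (hp : p E = p F) (hp0 : p E ≠ 0) (hA : E ∪ F ∈ S.part n) {a b : Ω} (ha : a ∈ E)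
    (hb : b ∈ F) : (M (n + 1) a - M n a) + (M (n + 1) b - M n b) = 0 := by
  have hd := hM.constOn_increment n
  refine eq_zero_of_forall_dual fun φ => ?_
  have hzero := hM.2 (n + 1) (by omega) _ (MartingaleSetup.memAlg_of_mem_part hA) φ
  simp only [Nat.add_sub_cancel] at hzero
  have hdi : Integrable (fun ω => φ (M (n + 1) ω - M n ω)) p :=
    MartingaleSetup.ConstOn.integrable (S := S) (n := n + 1)
      (fun E hE ω hω ω' hω' => congrArg φ (hd E hE ω hω ω' hω')) _
  rw [setIntegral_union hEF (S.meas _ F hF) hdi.integrableOn hdi.integrableOn,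
    setIntegral_congr_fun (S.meas _ E hE) (fun ω hω => congrArg φ (hd E hE ω hω a ha)),
    setIntegral_congr_fun (S.meas _ F hF) (fun ω hω => congrArg φ (hd F hF ω hω b hb)),
    setIntegral_const, setIntegral_const, measureReal_def, measureReal_def, ← hp, ← smul_add,
    ← map_add] at hzero
  exact (smul_eq_zero.1 hzero).resolve_left (ENNReal.toReal_ne_zero.2 ⟨hp0, measure_ne_top _ _⟩)

theorem IsSimpleMartingale.increment_eq_zero (hM : IsSimpleMartingale S M) {n : ℕ}
    {A : Set Ω} (hA : A ∈ S.part n) (hA' : A ∈ S.part (n + 1)) (hp0 : p A ≠ 0) {a : Ω}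
    (ha : a ∈ A) : M (n + 1) a - M n a = 0 := by
  have hd := hM.constOn_increment n
  refine eq_zero_of_forall_dual fun φ => ?_
  have hzero := hM.2 (n + 1) (by omega) _ (MartingaleSetup.memAlg_of_mem_part hA) φ
  simp only [Nat.add_sub_cancel] at hzero
  rw [setIntegral_congr_fun (S.meas _ A hA) (fun ω hω => congrArg φ (hd A hA' ω hω a ha)),
    setIntegral_const] at hzero
  exact (smul_eq_zero.1 hzero).resolve_left (ENNReal.toReal_ne_zero.2 ⟨hp0, measure_ne_top _ _⟩)

/-- The gain on the union of a nondegenerate Walsh-Paley pair on which the increment lies in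
`U_i(t)`. -/
theorem IsSimpleMartingale.gain_on_pair (hM : IsSimpleMartingale S M) {t : ℝ} (ht : 0 < t)
    {i : ℕ} (hi : 1 ≤ i) {n : ℕ} {E F : Set Ω} (hE : E ∈ S.part (n + 1))
    (hF : F ∈ S.part (n + 1)) (hEF : Disjoint E F) (hp : p E = p F) (hp0 : p E ≠ 0)
    (hA : E ∪ F ∈ S.part n) {ω₀ : Ω} (hω₀ : ω₀ ∈ E ∪ F)
    (hU : M (n + 1) ω₀ - M n ω₀ ∈ UredBall X t i) :
    (∫ ω in E ∪ F, ‖M n ω‖ ^ 2 ∂p) +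
        (i : ℝ)⁻¹ * ((∫ ω in E ∪ F, ‖M (n + 1) ω - M n ω‖ ^ 2 ∂p) -
          (t ^ 2)⁻¹ * ∫ ω in E ∪ F, ‖M n ω‖ ^ 2 ∂p) ≤
      ∫ ω in E ∪ F, ‖M (n + 1) ω‖ ^ 2 ∂p := by
  obtain ⟨a, ha⟩ := nonempty_of_measure_ne_zero hp0
  obtain ⟨b, hb⟩ := nonempty_of_measure_ne_zero (hp ▸ hp0)
  have hd := hM.constOn_increment n
  have hsum := hM.increment_add_eq_zero hE hF hEF hp hp0 hA ha hb
  have hyb : M n b = M n a := hM.1 n _ hA b (Or.inr hb) a (Or.inl ha)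
  have integral_union : ∀ f : Ω → X, S.ConstOn (n + 1) f →
      ∫ ω in E ∪ F, ‖f ω‖ ^ 2 ∂p = p.real E * (‖f a‖ ^ 2 + ‖f b‖ ^ 2) := by
    intro f hf
    have hdi : Integrable (fun ω => ‖f ω‖ ^ 2) p :=
      MartingaleSetup.ConstOn.integrable (S := S) (n := n + 1)
        (fun E hE ω hω ω' hω' => by simp only [hf E hE ω hω ω' hω']) _
    rw [setIntegral_union hEF (S.meas _ F hF) hdi.integrableOn hdi.integrableOn,
      setIntegral_congr_fun (S.meas _ E hE)
        (fun ω hω => congrArg (fun v => ‖v‖ ^ 2) (hf E hE ω hω a ha)),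
      setIntegral_congr_fun (S.meas _ F hF)
        (fun ω hω => congrArg (fun v => ‖v‖ ^ 2) (hf F hF ω hω b hb)),
      setIntegral_const, setIntegral_const, measureReal_def, measureReal_def, ← hp]
    simp only [smul_eq_mul]
    ring
  rw [integral_union _ (MartingaleSetup.ConstOn.succ (hM.1 n)), integral_union _ hd,
    integral_union _ (hM.1 (n + 1))]
  set x := M (n + 1) a - M n a with hx
  have hxb : M (n + 1) b - M n b = -x := (neg_eq_of_add_eq_zero_right hsum).symm
  have hxU : x ∈ UredBall X t i := by
    rcases hω₀ with h | h
    · have h1 : M (n + 1) ω₀ - M n ω₀ = x := hd E hE ω₀ h a ha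
      rwa [h1] at hU
    · have h1 : M (n + 1) ω₀ - M n ω₀ = -x := (hd F hF ω₀ h b hb).trans hxb
      rw [h1] at hU
      simpa using UredBall.neg_mem hU
  have ea : M (n + 1) a = M n a + x := by rw [hx]; abel
  have eb : M (n + 1) b = M n a - x := by
    rw [sub_eq_add_neg, ← hxb, hyb]; abel
  have hgain := UredBall.norm_sq_gain ht hi hxU (M n a)
  have h := mul_le_mul_of_nonneg_left hgain (measureReal_nonneg (μ := p) (s := E))
  rw [hxb, hyb, ea, eb, norm_neg]
  linarith

theorem IsSimpleMartingale.gain_on_part (hM : IsSimpleMartingale S M) {t : ℝ} (ht : 0 < t)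
    {i : ℕ} (hi : 1 ≤ i) {n : ℕ} {A : Set Ω} (hA : A ∈ S.part n) :
    (∫ ω in A, ‖M n ω‖ ^ 2 ∂p) +
        (i : ℝ)⁻¹ * ((∫ ω in A ∩ ((fun ω => M (n + 1) ω - M n ω) ⁻¹' (UredBall X t i) ∩
            S.wpUnion (n + 1)), ‖M (n + 1) ω - M n ω‖ ^ 2 ∂p) -
          (t ^ 2)⁻¹ * ∫ ω in A, ‖M n ω‖ ^ 2 ∂p) ≤
      ∫ ω in A, ‖M (n + 1) ω‖ ^ 2 ∂p := by
  have hd := hM.constOn_increment n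
  have hdi : Integrable (fun ω => ‖M (n + 1) ω - M n ω‖ ^ 2) p :=
    MartingaleSetup.ConstOn.integrable (S := S) (n := n + 1)
      (fun E hE ω hω ω' hω' => congrArg (fun v => ‖v‖ ^ 2) (hd E hE ω hω ω' hω')) _
  set W := (fun ω => M (n + 1) ω - M n ω) ⁻¹' (UredBall X t i) ∩ S.wpUnion (n + 1)
  have hWA : ∫ ω in A ∩ W, ‖M (n + 1) ω - M n ω‖ ^ 2 ∂p ≤
      ∫ ω in A, ‖M (n + 1) ω - M n ω‖ ^ 2 ∂p :=
    setIntegral_mono_set hdi.integrableOn (Eventually.of_forall fun ω => sq_nonneg _)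
      (Eventually.of_forall fun ω hω => hω.1)
  have hi0 : (0 : ℝ) ≤ (i : ℝ)⁻¹ := by positivity
  have of_nonpos : ∫ ω in A ∩ W, ‖M (n + 1) ω - M n ω‖ ^ 2 ∂p ≤ 0 →
      (∫ ω in A, ‖M n ω‖ ^ 2 ∂p) +
        (i : ℝ)⁻¹ * ((∫ ω in A ∩ W, ‖M (n + 1) ω - M n ω‖ ^ 2 ∂p) -
          (t ^ 2)⁻¹ * ∫ ω in A, ‖M n ω‖ ^ 2 ∂p) ≤ ∫ ω in A, ‖M (n + 1) ω‖ ^ 2 ∂p := by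
    intro h0
    have hJ := hM.integral_norm_sq_le hA
    have hnn : 0 ≤ (t ^ 2)⁻¹ * ∫ ω in A, ‖M n ω‖ ^ 2 ∂p := by positivity
    have := mul_nonpos_of_nonneg_of_nonpos hi0 (sub_nonpos.2 (h0.trans hnn))
    linarith
  by_cases hp0 : p A = 0
  · exact of_nonpos (hWA.trans_eq (setIntegral_measure_zero _ hp0))
  rcases (A ∩ W).eq_empty_or_nonempty with hAW | ⟨ω₀, hω₀A, hω₀U, hω₀⟩
  · exact of_nonpos (by simp [hAW])
  obtain ⟨_, ⟨E, F, hE, hF, hp, hEF, hor⟩, hω₀'⟩ := hω₀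
  rw [Nat.add_sub_cancel] at hEF
  have hω₀EF : ω₀ ∈ E ∪ F := by
    rcases hor with rfl | rfl
    exacts [Or.inl hω₀', Or.inr hω₀']
  obtain rfl : A = E ∪ F := by
    by_contra hne
    exact Set.disjoint_left.1 (S.disj n hA hEF hne) hω₀A hω₀EF
  rcases eq_or_ne E F with rfl | hne
  · rw [Set.union_self] at *
    refine of_nonpos (hWA.trans_eq (setIntegral_eq_zero_of_forall_eq_zero fun ω hω => ?_))
    rw [hM.increment_eq_zero hA hE hp0 hω]
    simp
  · have hpE : p E ≠ 0 := fun h => hp0 (measure_union_null h (hp ▸ h))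
    refine le_trans ?_
      (hM.gain_on_pair ht hi hE hF (S.disj _ hE hF hne) hp hpE hEF hω₀EF hω₀U)
    gcongr

end Increment

/-- If `sup_n E‖M_n‖² ≤ 1` and `∫_{(dM_n)⁻¹(U_i(t)) ∩ Ω_n} ‖dM_n‖² dp ≥ 2t⁻²`, then
`E‖M_n‖² ≥ E‖M_{n-1}‖² + t⁻²i⁻¹`. -/
theorem stmt9 {X : Type*} [NormedAddCommGroup X] [NormedSpace ℝ X]
    {Ω : Type*} [MeasurableSpace Ω] {p : Measure Ω} [IsProbabilityMeasure p]
    (S : MartingaleSetup Ω p) (M : ℕ → Ω → X) (hM : IsSimpleMartingale S M)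
    (t : ℝ) (ht : 0 < t) (i : ℕ) (hi : 1 ≤ i)
    (hbound : ∀ m, ∫ ω, ‖M m ω‖ ^ 2 ∂p ≤ 1)
    (n : ℕ) (hn : 1 ≤ n)
    (hbig : 2 * (t ^ 2)⁻¹ ≤
      ∫ ω in ((fun ω => M n ω - M (n - 1) ω) ⁻¹' (UredBall X t i)) ∩ S.wpUnion n,
        ‖M n ω - M (n - 1) ω‖ ^ 2 ∂p) :
    (∫ ω, ‖M (n - 1) ω‖ ^ 2 ∂p) + (t ^ 2)⁻¹ * (i : ℝ)⁻¹ ≤ ∫ ω, ‖M n ω‖ ^ 2 ∂p := by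
  obtain ⟨m, rfl⟩ : ∃ m, n = m + 1 := ⟨n - 1, by omega⟩
  simp only [Nat.add_sub_cancel] at hbig ⊢
  have hd := hM.constOn_increment m
  have hsq : ∀ k, Integrable (fun ω => ‖M k ω‖ ^ 2) p := fun k =>
    MartingaleSetup.ConstOn.integrable (S := S) (n := k)
      (fun E hE ω hω ω' hω' => congrArg (fun v => ‖v‖ ^ 2) (hM.1 k E hE ω hω ω' hω')) _
  have hsum := Finset.sum_le_sum fun A hA => hM.gain_on_part ht hi (n := m) (A := A) hA
  rw [Finset.sum_add_distrib, ← Finset.mul_sum, Finset.sum_sub_distrib, ← Finset.mul_sum,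
    ← S.integral_eq_sum_part m (hsq m), ← S.integral_eq_sum_part m (hsq (m + 1))] at hsum
  rw [S.integral_eq_sum_part m (MartingaleSetup.ConstOn.integrable (S := S) (n := m + 1)
      (fun E hE ω hω ω' hω' => congrArg (fun v => ‖v‖ ^ 2) (hd E hE ω hω ω' hω')) _),
    Finset.sum_congr rfl fun A hA => by rw [Measure.restrict_restrict (S.meas m A hA)]] at hbig
  have hle : (t ^ 2)⁻¹ * ∫ ω, ‖M m ω‖ ^ 2 ∂p ≤ (t ^ 2)⁻¹ * 1 :=
    mul_le_mul_of_nonneg_left (hbound m) (by positivity)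
  have hgain := mul_le_mul_of_nonneg_left (sub_le_sub hbig hle)
    (by positivity : (0 : ℝ) ≤ (i : ℝ)⁻¹)
  linarith
end

section
/- For a compact Hausdorff space K the following are equivalent: (1) K supports a strictly positive measure; (2) the family 𝒢 of all nonempty open subsets of K admits a countable decomposition 𝒢 = ⋃_{n=1}^∞ 𝒢_n such that win(𝒢_n) > 0 for all n. -/
open MeasureTheory Filter Topology

/-- `l(𝒟)`: the least `k` such that every subfamily of `𝒟` with more than `k` members
has empty intersection. -/
noncomputable def interNum {α : Type*} (D : Finset (Set α)) : ℕ :=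
  sInf {k : ℕ | ∀ A : Finset (Set α), A ⊆ D → k < A.card → ⋂₀ (↑A : Set (Set α)) = ∅}

/-- The weak intersection number `win(ℬ)` is positive: some `c > 0` is a lower bound for
`l(𝒟)/|𝒟|` over all nonempty finite subfamilies `𝒟 ⊆ ℬ`. -/
def WinPos {α : Type*} (B : Set (Set α)) : Prop :=
  ∃ c : ℝ, 0 < c ∧ ∀ D : Finset (Set α), ↑D ⊆ B → D.Nonempty →
    c ≤ (interNum D : ℝ) / D.card

theorem card_le_interNum {α : Type*} {D A : Finset (Set α)} (hA : A ⊆ D) {x : α}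
    (hx : ∀ a ∈ A, x ∈ a) : A.card ≤ interNum D := by
  have hmem : interNum D ∈ {k : ℕ | ∀ A : Finset (Set α), A ⊆ D → k < A.card →
      ⋂₀ (↑A : Set (Set α)) = ∅} :=
    Nat.sInf_mem ⟨D.card, fun A hA hlt => absurd (Finset.card_le_card hA) (not_le.mpr hlt)⟩
  by_contra hlt
  have hempty := hmem A hA (not_le.mp hlt)
  have : x ∈ ⋂₀ (↑A : Set (Set α)) := fun a ha => hx a ha
  simp [hempty] at this

theorem exists_card_eq_interNum {α : Type*} {D : Finset (Set α)} (h : 0 < interNum D) :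
    ∃ A ⊆ D, interNum D ≤ A.card ∧ ∃ x, ∀ a ∈ A, x ∈ a := by
  have hnot := Nat.notMem_of_lt_sInf (show interNum D - 1 < interNum D by omega)
  simp only [Set.mem_ofPred_eq, not_forall] at hnot
  obtain ⟨A, hA, hlt, hne⟩ := hnot
  obtain ⟨x, hx⟩ := Set.nonempty_iff_ne_empty.mpr hne
  exact ⟨A, hA, by omega, x, fun a ha => hx a ha⟩

theorem exists_injective_of_forall_infinite {ι α : Type*} [Finite ι] {t : ι → Set α}
    (ht : ∀ i, (t i).Infinite) : ∃ f : ι → α, Function.Injective f ∧ ∀ i, f i ∈ t i := by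
  classical
  have := Fintype.ofFinite ι
  choose u hut hu using fun i => (ht i).exists_subset_card_eq (Fintype.card ι)
  obtain ⟨f, hf, hfu⟩ := (Finset.all_card_le_biUnion_card_iff_exists_injective u).mp <| by
    intro s
    obtain rfl | ⟨i, hi⟩ := s.eq_empty_or_nonempty
    · simp
    · calc s.card ≤ Fintype.card ι := Finset.card_le_univ s
        _ = (u i).card := (hu i).symm
        _ ≤ _ := Finset.card_le_card (Finset.subset_biUnion_of_mem u hi)
  exact ⟨f, hf, fun i => hut i (hfu i)⟩

/-- If each `V i` contains infinitely many members of a family whose weak intersection number is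
at least `c`, then the `V i` satisfy the intersection property with multiplicities. -/
theorem exists_mul_sum_le_of_infinite_subsets {α ι : Type*} [Fintype ι] {B : Set (Set α)} {c : ℝ}
    (hc : 0 < c)
    (hB : ∀ D : Finset (Set α), ↑D ⊆ B → D.Nonempty → c ≤ (interNum D : ℝ) / D.card)
    {V : ι → Set α} (hV : ∀ i, {G ∈ B | G ⊆ V i}.Infinite) (m : ι → ℕ) (hm : 0 < ∑ i, m i) :
    ∃ x, c * (∑ i, m i : ℕ) ≤ ∑ i, (V i).indicator (fun _ => (m i : ℝ)) x := by
  classical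
  obtain ⟨f, hf, hfV⟩ := exists_injective_of_forall_infinite
    (ι := Σ i, Fin (m i)) (t := fun p => {G ∈ B | G ⊆ V p.1}) fun p => hV p.1
  set D : Finset (Set α) := Finset.univ.image f with hD
  have hcard : D.card = ∑ i, m i := by
    rw [hD, Finset.card_image_of_injective _ hf]
    simp
  have hcD : c ≤ (interNum D : ℝ) / D.card := by
    refine hB D ?_ (Finset.card_pos.mp (by omega))
    intro G hG
    obtain ⟨p, -, rfl⟩ := Finset.mem_image.mp (Finset.mem_coe.mp hG)
    exact (hfV p).1
  have hDpos : (0 : ℝ) < D.card := by rw [hcard]; exact_mod_cast hm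
  rw [le_div_iff₀ hDpos, hcard] at hcD
  have hpos : 0 < interNum D := by
    have : (0 : ℝ) < interNum D :=
      lt_of_lt_of_le (mul_pos hc (by exact_mod_cast hm)) hcD
    exact_mod_cast this
  obtain ⟨A, hAD, hAcard, x, hx⟩ := exists_card_eq_interNum hpos
  refine ⟨x, hcD.trans ?_⟩
  have hsub : A ⊆ (Finset.univ.filter fun p : Σ i, Fin (m i) => x ∈ V p.1).image f := by
    intro G hG
    obtain ⟨p, -, rfl⟩ := Finset.mem_image.mp (hAD hG)
    exact Finset.mem_image_of_mem _ (by simpa using (hfV p).2 (hx _ hG))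
  have hle : interNum D ≤ (Finset.univ.filter fun p : Σ i, Fin (m i) => x ∈ V p.1).card :=
    hAcard.trans ((Finset.card_le_card hsub).trans Finset.card_image_le)
  calc (interNum D : ℝ)
      ≤ ((Finset.univ.filter fun p : Σ i, Fin (m i) => x ∈ V p.1).card : ℝ) := by exact_mod_cast hle
    _ = ∑ i, (V i).indicator (fun _ => (m i : ℝ)) x := by
      rw [Finset.card_filter, Fintype.sum_sigma]
      push_cast
      refine Finset.sum_congr rfl fun i _ => ?_
      by_cases hxi : x ∈ V i <;> simp [hxi]

/-- A version of `exists_mul_sum_le_of_infinite_subsets` for convex combinations of functions. -/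
theorem exists_half_le_sum_mul_of_infinite_subsets {α ι : Type*} [Fintype ι] {B : Set (Set α)}
    {c : ℝ} (hc : 0 < c)
    (hB : ∀ D : Finset (Set α), ↑D ⊆ B → D.Nonempty → c ≤ (interNum D : ℝ) / D.card)
    {f : ι → α → ℝ} (hf : ∀ i x, 0 ≤ f i x)
    (hV : ∀ i, {G ∈ B | G ⊆ {x | 1 < f i x}}.Infinite)
    {w : ι → ℝ} (hw : ∀ i, 0 ≤ w i) (hw1 : ∑ i, w i = 1) :
    ∃ x, c / 2 ≤ ∑ i, w i * f i x := by
  have hk : 0 < Fintype.card ι := by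
    refine Fintype.card_pos_iff.mpr (not_isEmpty_iff.mp fun h => ?_)
    simp at hw1
  set N : ℕ := 2 * Fintype.card ι with hN
  have hNpos : (0 : ℝ) < N := by exact_mod_cast (by omega : 0 < N)
  have hlow : (N : ℝ) / 2 ≤ (∑ i, ⌊w i * N⌋₊ : ℕ) := by
    have h1 : ∑ i, (w i * N - 1) ≤ ∑ i, (⌊w i * N⌋₊ : ℝ) :=
      Finset.sum_le_sum fun i _ => (Nat.sub_one_lt_floor _).le
    rw [Finset.sum_sub_distrib, ← Finset.sum_mul, hw1] at h1
    push_cast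
    refine le_trans (le_of_eq ?_) h1
    simp [hN]
    ring
  have hmpos : 0 < ∑ i, ⌊w i * N⌋₊ := by
    have : (0 : ℝ) < (∑ i, ⌊w i * N⌋₊ : ℕ) := by linarith
    exact_mod_cast this
  obtain ⟨x, hx⟩ := exists_mul_sum_le_of_infinite_subsets hc hB hV _ hmpos
  refine ⟨x, ?_⟩
  have hup : ∑ i, {x | 1 < f i x}.indicator (fun _ => (⌊w i * N⌋₊ : ℝ)) x
      ≤ N * ∑ i, w i * f i x := by
    rw [Finset.mul_sum]
    refine Finset.sum_le_sum fun i _ => ?_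
    have hwN : 0 ≤ w i * N := mul_nonneg (hw i) hNpos.le
    rw [← mul_assoc, mul_comm (N : ℝ), Set.indicator_apply]
    split_ifs with hxi
    · exact (Nat.floor_le hwN).trans (le_mul_of_one_le_right hwN (le_of_lt hxi))
    · exact mul_nonneg hwN (hf i x)
  have h2 : c * (N / 2) ≤ N * ∑ i, w i * f i x :=
    (mul_le_mul_of_nonneg_left hlow hc.le).trans (hx.trans hup)
  nlinarith

/-- A family with positive weak intersection number carries a finite measure which is positive on
all open sets that robustly contain infinitely many members of the family. -/
theorem WinPos.exists_measure {K : Type*} [TopologicalSpace K] [CompactSpace K] [T2Space K]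
    [MeasurableSpace K] [BorelSpace K] {B : Set (Set K)} (hB : WinPos B) :
    ∃ μ : Measure K, IsFiniteMeasure μ ∧ ∀ f : C(K, ℝ), 0 ≤ f →
      {G ∈ B | G ⊆ {x | 1 < f x}}.Infinite → 0 < ∫ x, f x ∂μ := by
  obtain ⟨c, hc, hB⟩ := hB
  let T : Set C(K, ℝ) := {f | 0 ≤ f ∧ {G ∈ B | G ⊆ {x | 1 < f x}}.Infinite}
  let S : Set C(K, ℝ) := {f | Set.MapsTo f Set.univ (Set.Iio (c / 2))}
  have hSo : IsOpen S := ContinuousMap.isOpen_setOfPred_mapsTo isCompact_univ isOpen_Iio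
  have hSc : Convex ℝ S := by
    intro f hf g hg a b ha hb hab x hx
    exact convex_Iio (c / 2) (hf hx) (hg hx) ha hb hab
  have hdisj : Disjoint S (convexHull ℝ T) := by
    rw [Set.disjoint_left]
    intro g hgS hgT
    obtain ⟨ι, _, w, z, hw, hw1, hz, rfl⟩ := mem_convexHull_iff_exists_fintype.mp hgT
    obtain ⟨x, hx⟩ := exists_half_le_sum_mul_of_infinite_subsets hc hB
      (f := fun i x => z i x) (fun i x => (hz i).1 x) (fun i => (hz i).2) hw hw1
    have := hgS (Set.mem_univ x)
    simp only [Set.mem_Iio, ContinuousMap.coe_sum, Finset.sum_apply, ContinuousMap.coe_smul,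
      Pi.smul_apply, smul_eq_mul] at this
    linarith
  obtain ⟨L, u, hLS, hLT⟩ := geometric_hahn_banach_open hSc hSo (convex_convexHull ℝ T) hdisj
  have hu : 0 < u := by
    have h0 : (0 : C(K, ℝ)) ∈ S := fun x _ => by simpa using half_pos hc
    simpa using hLS 0 h0
  have hLpos : ∀ g : C(K, ℝ), 0 ≤ g → 0 ≤ L g := by
    intro g hg
    by_contra! hneg
    have hmem : (u / L g) • g ∈ S := by
      intro x _
      have h1 : u / L g ≤ 0 := (div_neg_of_pos_of_neg hu hneg).le
      have h2 : u / L g * g x ≤ 0 := mul_nonpos_of_nonpos_of_nonneg h1 (hg x)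
      have : u / L g * g x < c / 2 := by linarith
      simpa using this
    have := hLS _ hmem
    rw [map_smul, smul_eq_mul, div_mul_cancel₀ _ hneg.ne] at this
    exact lt_irrefl _ this
  let Λ : CompactlySupportedContinuousMap K ℝ →ₚ[ℝ] ℝ :=
    { toFun := fun g => L g.toContinuousMap
      map_add' := fun g h => L.map_add g.toContinuousMap h.toContinuousMap
      map_smul' := fun a g => L.map_smul a g.toContinuousMap
      monotone' := fun g h hgh => by
        have := hLpos (h.toContinuousMap - g.toContinuousMap) fun x => sub_nonneg.mpr (hgh x)
        rwa [map_sub, sub_nonneg] at this }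
  refine ⟨RealRMK.rieszMeasure Λ, inferInstance, fun f hf0 hfi => ?_⟩
  have hInt := RealRMK.integral_rieszMeasure Λ
    ⟨f, HasCompactSupport.of_compactSpace _⟩
  have hfL : u ≤ L f := hLT f (subset_convexHull ℝ T ⟨hf0, hfi⟩)
  exact lt_of_lt_of_le (hu.trans_le hfL) (le_of_eq hInt.symm)

/-- A family with positive weak intersection number has only finitely many singletons. -/
theorem WinPos.finite_singletons {α : Type*} {B : Set (Set α)} (hB : WinPos B) :
    {x | {x} ∈ B}.Finite := by
  classical
  obtain ⟨c, hc, hB⟩ := hB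
  by_contra hinf
  obtain ⟨n, hn⟩ := exists_nat_gt (1 / c)
  obtain ⟨s, hs, hsn⟩ := Set.Infinite.exists_subset_card_eq hinf (n + 1)
  have hinj : Function.Injective (fun x : α => ({x} : Set α)) := Set.singleton_injective
  have hcard : (s.image fun x : α => ({x} : Set α)).card = n + 1 := by
    rw [Finset.card_image_of_injective _ hinj, hsn]
  have hle := hB (s.image fun x => {x}) (by
    intro G hG
    obtain ⟨x, hx, rfl⟩ := Finset.mem_image.mp (Finset.mem_coe.mp hG)
    exact hs hx) (Finset.card_pos.mp (by omega))
  have hone : interNum (s.image fun x : α => ({x} : Set α)) ≤ 1 := by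
    refine Nat.sInf_le fun A hA hlt => ?_
    obtain ⟨a, ha, b, hb, hab⟩ := Finset.one_lt_card.mp hlt
    obtain ⟨x, -, rfl⟩ := Finset.mem_image.mp (hA ha)
    obtain ⟨y, -, rfl⟩ := Finset.mem_image.mp (hA hb)
    refine Set.eq_empty_of_forall_notMem fun z hz => hab ?_
    have hzx : z = x := hz _ ha
    have hzy : z = y := hz _ hb
    rw [← hzx, ← hzy]
  rw [hcard, le_div_iff₀ (by positivity)] at hle
  have h1 : (interNum (s.image fun x : α => ({x} : Set α)) : ℝ) ≤ 1 := by exact_mod_cast hone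
  rw [div_lt_iff₀ hc] at hn
  push_cast at hle
  nlinarith

/-- An infinite open subset of a Hausdorff space has uncountably many nonempty open subsets. -/
theorem IsOpen.not_countable_open_subsets {X : Type*} [TopologicalSpace X] [T2Space X] {V : Set X}
    (hV : IsOpen V) (hinf : V.Infinite) :
    ¬ {G : Set X | (IsOpen G ∧ G.Nonempty) ∧ G ⊆ V}.Countable := by
  have := hinf.to_subtype
  obtain ⟨U, hUi, hUo, hUd⟩ := exists_seq_infinite_isOpen_pairwise_disjoint V
  choose p hp using fun n => (hUi n).nonempty
  let F : Set ℕ → Set X := fun s => Subtype.val '' ⋃ n ∈ s, U n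
  have hpF : ∀ n s, (p n : X) ∈ F s ↔ n ∈ s := by
    intro n s
    simp only [F, Subtype.val_injective.mem_set_image, Set.mem_iUnion]
    constructor
    · rintro ⟨m, hm, hpm⟩
      by_contra hn
      exact Set.disjoint_left.mp (hUd fun h : n = m => hn (h ▸ hm)) (hp n) hpm
    · exact fun hn => ⟨n, hn, hp n⟩
  have hF : Function.Injective F := fun s t hst => by
    ext n
    rw [← hpF n s, hst, hpF]
  intro hcount
  have hpre : {s : Set ℕ | s.Nonempty}.Countable := by
    refine (hcount.preimage hF).mono fun s hs => ?_
    obtain ⟨n, hn⟩ := hs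
    refine ⟨⟨hV.isOpenMap_subtype_val _ (isOpen_biUnion fun n _ => hUo n),
      p n, (hpF n s).mpr hn⟩, ?_⟩
    rintro _ ⟨y, -, rfl⟩
    exact y.2
  have huniv : (Set.univ : Set (Set ℕ)).Countable := by
    refine (hpre.insert ∅).mono fun s _ => ?_
    rcases s.eq_empty_or_nonempty with h | h
    · exact Or.inl h
    · exact Or.inr h
  have : Countable (Set ℕ) := Set.countable_univ_iff.mp huniv
  obtain ⟨g, hg⟩ := exists_injective_nat (Set ℕ)
  exact Function.cantor_injective g hg

theorem winPos_of_forall_le_measure {α : Type*} [MeasurableSpace α] (μ : Measure α)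
    [IsFiniteMeasure μ] {B : Set (Set α)} (hmeas : ∀ G ∈ B, MeasurableSet G) {ε : ℝ} (hε : 0 < ε)
    (hB : ∀ G ∈ B, ε ≤ μ.real G) : WinPos B := by
  classical
  refine ⟨ε / (μ.real Set.univ + 1), by positivity, fun D hD hne => ?_⟩
  have hDpos : (0 : ℝ) < D.card := by exact_mod_cast hne.card_pos
  rw [div_le_div_iff₀ (by positivity) hDpos]
  have hsum : ∑ G ∈ D, μ.real G ≤ interNum D * μ.real Set.univ := by
    have hInt : ∀ G ∈ D, Integrable (G.indicator fun _ => (1 : ℝ)) μ := fun G hG =>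
      (integrable_const 1).indicator (hmeas G (hD hG))
    calc ∑ G ∈ D, μ.real G = ∑ G ∈ D, ∫ x, G.indicator (fun _ => (1 : ℝ)) x ∂μ := by
          refine Finset.sum_congr rfl fun G hG => ?_
          rw [integral_indicator_const _ (hmeas G (hD hG))]
          simp
      _ = ∫ x, ∑ G ∈ D, G.indicator (fun _ => (1 : ℝ)) x ∂μ := (integral_finsetSum D hInt).symm
      _ ≤ ∫ _, (interNum D : ℝ) ∂μ := by
          refine integral_mono (integrable_finsetSum D hInt) (integrable_const _) fun x => ?_
          have := card_le_interNum (D := D) (Finset.filter_subset (fun G => x ∈ G) D) (x := x)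
            (by simp)
          simp only [Set.indicator_apply, Finset.sum_boole]
          exact_mod_cast this
      _ = interNum D * μ.real Set.univ := by simp [mul_comm]
  have hcard : D.card * ε ≤ ∑ G ∈ D, μ.real G := by
    rw [← nsmul_eq_mul]
    exact Finset.card_nsmul_le_sum D _ _ fun G hG => hB G (hD hG)
  have : (0 : ℝ) ≤ interNum D := Nat.cast_nonneg _
  nlinarith

/-- Kelley/Galvin–Prikry characterization: `K` supports a strictly positive measure iff the
nonempty open sets decompose into countably many families with positive weak intersection
number. -/
theorem stmt12 {K : Type*} [TopologicalSpace K] [CompactSpace K] [T2Space K]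
    [MeasurableSpace K] [BorelSpace K] :
    (∃ μ : Measure K, IsFiniteMeasure μ ∧
      ∀ G : Set K, IsOpen G → G.Nonempty → 0 < μ G) ↔
    (∃ 𝒢 : ℕ → Set (Set K), (⋃ n, 𝒢 n) = {G : Set K | IsOpen G ∧ G.Nonempty} ∧
      ∀ n, WinPos (𝒢 n)) := by
  constructor
  · rintro ⟨μ, _, hμ⟩
    refine ⟨fun n => {G | (IsOpen G ∧ G.Nonempty) ∧ 1 / ((n : ℝ) + 1) ≤ μ.real G}, ?_, fun n => ?_⟩
    · ext G
      simp only [Set.mem_iUnion, Set.mem_ofPred_eq, exists_and_left, and_iff_left_iff_imp]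
      rintro ⟨hGo, hGn⟩
      have hpos : 0 < μ.real G := ENNReal.toReal_pos (hμ G hGo hGn).ne' (measure_ne_top μ G)
      obtain ⟨n, hn⟩ := exists_nat_one_div_lt hpos
      exact ⟨n, hn.le⟩
    · exact winPos_of_forall_le_measure μ (fun G hG => hG.1.1.measurableSet)
        Nat.one_div_pos_of_nat fun G hG => hG.2
  · rintro ⟨𝒢, h𝒢, hwin⟩
    choose μ hfin hμ using fun n => (hwin n).exists_measure
    let P : Set K := {x | IsOpen {x}}
    have hPc : P.Countable := by
      refine (Set.countable_iUnion fun n => (hwin n).finite_singletons.countable).mono ?_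
      intro x hx
      have : ({x} : Set K) ∈ ⋃ n, 𝒢 n := by rw [h𝒢]; exact ⟨hx, Set.singleton_nonempty x⟩
      simpa using this
    have := hPc.to_subtype
    set ν : Measure K := Measure.sum μ + Measure.sum fun p : P => Measure.dirac (p : K) with hν
    refine ⟨ν.toFinite, inferInstance, fun G hGo ⟨p, hp⟩ => pos_iff_ne_zero.mpr fun h0 => ?_⟩
    have hνG : ν G = 0 := absolutelyContinuous_toFinite ν h0
    have hνG' : Measure.sum μ G = 0 ∧ (Measure.sum fun p : P => Measure.dirac (p : K)) G = 0 := by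
      simpa [hν] using hνG
    simp only [Measure.sum_apply _ hGo.measurableSet, ENNReal.tsum_eq_zero] at hνG'
    obtain ⟨hμG, hδG⟩ := hνG'
    obtain ⟨f, hf0, hf1, hf01⟩ := exists_continuous_zero_one_of_isClosed hGo.isClosed_compl
      (isClosed_singleton (x := p)) (by simpa using hp)
    set V : Set K := {x | 1 < ((2 : ℝ) • f) x} with hV
    have hVo : IsOpen V := isOpen_lt continuous_const (map_continuous _)
    have hpV : p ∈ V := by
      have : f p = 1 := hf1 rfl
      simp [hV, this]
    have hVG : V ⊆ G := by
      intro x hx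
      by_contra hxG
      have : f x = 0 := hf0 hxG
      simp [hV, this] at hx
      linarith
    by_cases hVinf : V.Infinite
    · obtain ⟨n, hn⟩ : ∃ n, {W ∈ 𝒢 n | W ⊆ V}.Infinite := by
        by_contra! hall
        refine hVo.not_countable_open_subsets hVinf
          ((Set.countable_iUnion fun n => (hall n).countable).mono ?_)
        rintro W ⟨hW, hWV⟩
        obtain ⟨n, hn⟩ := Set.mem_iUnion.mp (h𝒢.ge hW)
        exact Set.mem_iUnion.mpr ⟨n, hn, hWV⟩
      have hpos := hμ n ((2 : ℝ) • f) (fun x => by simpa using (hf01 x).1) hn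
      have hzero : ∫ x, ((2 : ℝ) • f) x ∂(μ n) = 0 := by
        refine integral_eq_zero_of_ae ?_
        have : ∀ᵐ x ∂(μ n), x ∉ G := measure_eq_zero_iff_ae_notMem.mp (hμG n)
        filter_upwards [this] with x hx
        have : f x = 0 := hf0 hx
        simp [this]
      exact hpos.ne' hzero
    · have hpo : IsOpen ({p} : Set K) := by
        have hfinV : (V \ {p}).Finite := (Set.not_infinite.mp hVinf).subset Set.sdiff_subset
        have : ({p} : Set K) = V \ (V \ {p}) := by
          ext x
          simp only [Set.mem_singleton_iff, Set.mem_sdiff, not_and, not_not]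
          exact ⟨fun h => ⟨h.symm ▸ hpV, fun _ => h⟩, fun h => h.2 h.1⟩
        rw [this]
        exact hVo.sdiff hfinV.isClosed
      have := hδG ⟨p, hpo⟩
      rw [Measure.dirac_apply' _ hGo.measurableSet] at this
      simp [hp] at this
end

section
/- Let K be a compact Hausdorff space, let 𝒢 = {G_1, …, G_m} be a family of m ≥ 2 distinct nonempty open subsets of K with chosen functions f_{G_j} as in the context, and let g ∈ C(K). Then there exists a martingale setup with partitions ℰ_0, ℰ_1, ℰ_2 and a C(K)-valued discrete martingale (N_0, N_1, N_2) on a probability space (Ω, Σ, p) such that: (1) Ω_2 = Ω; (2) N_0(ω) = g for all ω ∈ Ω; (3) for every ω ∈ Ω, either dN_2(ω) ∈ 𝓕_𝒢 or −dN_2(ω) ∈ 𝓕_𝒢; and (4) ‖N_2(ω)‖_∞ ≤ max(‖g‖_∞, 1) + l(𝒢)/(m − 1) for all ω ∈ Ω. -/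
open MeasureTheory Filter Topology

/-- A discrete martingale with values in `X` over some martingale setup on some
probability space. -/
structure MartingaleData (X : Type*) [NormedAddCommGroup X] [NormedSpace ℝ X] where
  (Ω : Type)
  [mΩ : MeasurableSpace Ω]
  (p : Measure Ω)
  (prob : IsProbabilityMeasure p)
  (S : MartingaleSetup Ω p)
  (M : ℕ → Ω → X)
  (mart : IsSimpleMartingale S M)

attribute [instance] MartingaleData.mΩ

/-- The martingale setup on a finite space whose `n`-th partition consists of the classes of an
equivalence relation `R n`, the relations getting finer with `n`. -/
noncomputable def MartingaleSetup.ofSetoid {Ω : Type*} [Fintype Ω] [MeasurableSpace Ω]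
    [DiscreteMeasurableSpace Ω] (p : Measure Ω) (R : ℕ → Setoid Ω)
    (hR : ∀ n, R (n + 1) ≤ R n) : MartingaleSetup Ω p where
  part n := (Set.finite_range fun ω => {ω' | R n ω ω'}).toFinset
  meas n E _ := Set.Finite.measurableSet E.toFinite
  disj n := by
    intro A hA B hB hAB
    simp only [Set.Finite.coe_toFinset, Set.mem_range] at hA hB
    obtain ⟨a, rfl⟩ := hA
    obtain ⟨b, rfl⟩ := hB
    refine Set.disjoint_left.2 fun ω (ha : R n a ω) (hb : R n b ω) => hAB ?_
    have hab : R n a b := (R n).trans ha ((R n).symm hb)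
    ext ω'
    exact ⟨fun h => (R n).trans ((R n).symm hab) h, fun h => (R n).trans hab h⟩
  cover n := by
    refine Set.eq_univ_of_forall fun ω => ⟨{ω' | R n ω ω'}, ?_, (R n).refl ω⟩
    simp
  refines n E hE := by
    simp only [Set.Finite.mem_toFinset, Set.mem_range] at hE ⊢
    obtain ⟨a, rfl⟩ := hE
    exact ⟨_, ⟨a, rfl⟩, fun ω h => hR n h⟩

theorem MartingaleSetup.mem_part_ofSetoid {Ω : Type*} [Fintype Ω] [MeasurableSpace Ω]
    [DiscreteMeasurableSpace Ω] {p : Measure Ω} {R : ℕ → Setoid Ω}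
    {hR : ∀ n, R (n + 1) ≤ R n} {n : ℕ} {E : Set Ω} :
    E ∈ (MartingaleSetup.ofSetoid p R hR).part n ↔ ∃ ω, {ω' | R n ω ω'} = E := by
  simp [MartingaleSetup.ofSetoid]

open scoped Classical in
/-- On a finite space in which all points have the same mass, a process is a martingale as soon as
its increments sum to zero over every class of the previous partition. -/
theorem isSimpleMartingale_ofSetoid {Ω X : Type*} [Fintype Ω] [MeasurableSpace Ω]
    [DiscreteMeasurableSpace Ω] {p : Measure Ω} [IsFiniteMeasure p]
    [NormedAddCommGroup X] [NormedSpace ℝ X] {R : ℕ → Setoid Ω}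
    {hR : ∀ n, R (n + 1) ≤ R n} {M : ℕ → Ω → X} (c : ℝ) (hp : ∀ ω, p.real {ω} = c)
    (hM : ∀ n ω ω', R n ω ω' → M n ω = M n ω')
    (hsum : ∀ n ω, ∑ ω' with R n ω ω', (M (n + 1) ω' - M n ω') = 0) :
    IsSimpleMartingale (MartingaleSetup.ofSetoid p R hR) M := by
  refine ⟨fun n E hE ω hω ω' hω' => ?_, fun n hn E hE φ => ?_⟩
  · obtain ⟨a, rfl⟩ := MartingaleSetup.mem_part_ofSetoid.1 hE
    exact hM n _ _ ((R n).trans ((R n).symm hω) hω')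
  · obtain ⟨n, rfl⟩ : ∃ k, n = k + 1 := ⟨n - 1, by omega⟩
    obtain ⟨T, hT, rfl⟩ := hE
    rw [Nat.add_sub_cancel] at hT ⊢
    rw [Set.sUnion_eq_biUnion]
    simp only [Finset.mem_coe]
    rw [integral_biUnion_finset T (fun E hE => (MartingaleSetup.ofSetoid p R hR).meas n E (hT hE))
      (((MartingaleSetup.ofSetoid p R hR).disj n).subset (by exact_mod_cast hT))
      (fun _ _ => Integrable.of_finite)]
    refine Finset.sum_eq_zero fun E hE => ?_
    obtain ⟨a, rfl⟩ := MartingaleSetup.mem_part_ofSetoid.1 (hT hE)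
    rw [← integral_indicator (Set.Finite.measurableSet (Set.toFinite _)),
      integral_fintype Integrable.of_finite]
    simp only [hp, smul_eq_mul, Set.indicator_apply, Set.mem_ofPred_eq]
    rw [← Finset.mul_sum, ← Finset.sum_filter, ← map_sum, hsum, map_zero, mul_zero]

/-- If each `f G ≤ 1` and `f G = 0` unless `x ∈ G`, then the sum of the `f G` over `G ∈ D` is at most
`interNum D`. -/
theorem sum_le_interNum {α : Type*} (D : Finset (Set α)) (f : Set α → ℝ) (x : α)
    (h1 : ∀ G ∈ D, f G ≤ 1) (h0 : ∀ G ∈ D, x ∉ G → f G = 0) :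
    ∑ G ∈ D, f G ≤ interNum D := by
  classical
  have hmem := Nat.sInf_mem (s := {k : ℕ | ∀ A : Finset (Set α), A ⊆ D → k < A.card →
    ⋂₀ (↑A : Set (Set α)) = ∅}) ⟨D.card, fun A hA h => absurd (Finset.card_le_card hA) h.not_ge⟩
  have hcard : (D.filter (x ∈ ·)).card ≤ interNum D := by
    by_contra! hlt
    have hempty := hmem _ (Finset.filter_subset (x ∈ ·) D) hlt
    have hx : x ∈ ⋂₀ (↑(D.filter (x ∈ ·)) : Set (Set α)) := by
      intro G hG
      exact (Finset.mem_filter.1 (Finset.mem_coe.1 hG)).2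
    rw [hempty] at hx
    exact hx
  calc ∑ G ∈ D, f G ≤ ∑ G ∈ D, if x ∈ G then (1 : ℝ) else 0 := by
        refine Finset.sum_le_sum fun G hG => ?_
        split_ifs with hx
        exacts [h1 G hG, (h0 G hG hx).le]
    _ = ((D.filter (x ∈ ·)).card : ℝ) := by simp
    _ ≤ interNum D := by exact_mod_cast hcard

/-- Subtracting from `a` the multiple `t` of its truncation to `[-1, 1]` makes room for a further
perturbation of size `t`. -/
theorem abs_sub_mul_truncation_add_le {a t : ℝ} (ht1 : t ≤ 1) :
    |a - t * max (-1) (min 1 a)| + t ≤ max |a| 1 := by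
  rcases le_total a 1 with h | h
  · rw [min_eq_right h]
    rcases le_total (-1) a with h' | h'
    · rw [max_eq_right h', show a - t * a = (1 - t) * a by ring, abs_mul,
        abs_of_nonneg (sub_nonneg.2 ht1)]
      have : |a| ≤ 1 := abs_le.2 ⟨h', h⟩
      exact le_max_of_le_right (by nlinarith)
    · rw [max_eq_left h', abs_of_nonpos (by linarith), abs_of_nonpos (by linarith)]
      exact le_max_of_le_left (by linarith)
  · rw [min_eq_left h, max_eq_right (by norm_num), abs_of_nonneg (by linarith),
      abs_of_nonneg (by linarith)]
    exact le_max_of_le_left (by linarith)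

theorem abs_truncation_le_one (a : ℝ) : |max (-1) (min 1 a)| ≤ 1 :=
  abs_le.2 ⟨le_max_left _ _, max_le (by norm_num) (min_le_left _ _)⟩

/-- On `ι × Bool`: the trivial relation, then equality of first coordinates, then equality. -/
def branchSetoid (ι : Type*) : ℕ → Setoid (ι × Bool)
  | 0 => ⊤
  | 1 => Setoid.ker Prod.fst
  | _ + 2 => ⊥

theorem branchSetoid_succ_le (ι : Type*) : ∀ n, branchSetoid ι (n + 1) ≤ branchSetoid ι n
  | 0 => le_top
  | 1 => bot_le
  | _ + 2 => le_rfl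

/-- The process `g`, `g + v i`, `g + v i ± f i` on `ι × Bool`, constant from time `2` on. -/
def branchProcess {ι X : Type*} [AddCommGroup X] (g : X) (v f : ι → X) : ℕ → ι × Bool → X
  | 0, _ => g
  | 1, ω => g + v ω.1
  | _ + 2, ω => g + v ω.1 + bif ω.2 then f ω.1 else -f ω.1

/-- If `∑ i, v i = 0`, the branching process is a discrete martingale whose last step splits every
atom into a Walsh-Paley pair. -/
theorem exists_branching_martingaleData {ι : Type} [Fintype ι] [Nonempty ι] {X : Type*}
    [NormedAddCommGroup X] [NormedSpace ℝ X] (g : X) (v f : ι → X) (hv : ∑ i, v i = 0) :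
    ∃ T : MartingaleData X, T.S.wpUnion 2 = Set.univ ∧ (∀ ω, T.M 0 ω = g) ∧
      ∀ ω, ∃ i, T.M 1 ω = g + v i ∧
        (T.M 2 ω = g + v i + f i ∨ T.M 2 ω = g + v i + -f i) := by
  classical
  let _ : MeasurableSpace ι := ⊤
  have : DiscreteMeasurableSpace ι := ⟨fun _ => trivial⟩
  let p : Measure (ι × Bool) := ProbabilityTheory.uniformOn Set.univ
  have hprob : IsProbabilityMeasure p :=
    ProbabilityTheory.isProbabilityMeasure_uniformOn Set.finite_univ Set.univ_nonempty
  have hp (ω : ι × Bool) : p {ω} = 1 / Fintype.card (ι × Bool) := by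
    simp [p, ProbabilityTheory.uniformOn_univ]
  let S := MartingaleSetup.ofSetoid p (branchSetoid ι) (branchSetoid_succ_le ι)
  have hmem {n : ℕ} {E : Set (ι × Bool)} (ω : ι × Bool)
      (h : ∀ ω', branchSetoid ι n ω ω' ↔ ω' ∈ E) : E ∈ S.part n :=
    MartingaleSetup.mem_part_ofSetoid.2 ⟨ω, Set.ext h⟩
  have hwp : S.wpUnion 2 = Set.univ := by
    refine Set.eq_univ_of_forall fun ω => ⟨{ω}, ⟨{(ω.1, true)}, {(ω.1, false)},
      hmem (ω.1, true) fun ω' => eq_comm, hmem (ω.1, false) fun ω' => eq_comm, by rw [hp, hp],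
      hmem ω ?_, ?_⟩, rfl⟩
    · rintro ⟨i, b⟩
      change ω.1 = i ↔ _
      cases b <;> simp [eq_comm]
    · obtain ⟨i, b⟩ := ω
      cases b <;> simp
  have hmart : IsSimpleMartingale S (branchProcess g v f) := by
    refine isSimpleMartingale_ofSetoid (1 / Fintype.card (ι × Bool) : ENNReal).toReal
      (fun ω => by rw [Measure.real, hp]) ?_ ?_
    · rintro (_ | _ | n) ω ω' h
      · rfl
      · have h : ω.1 = ω'.1 := h
        simp [branchProcess, h]
      · have h : ω = ω' := h
        rw [h]
    · rintro (_ | _ | n) ω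
      · have h (ω' : ι × Bool) : branchSetoid ι 0 ω ω' := trivial
        simp [h, branchProcess, Fintype.sum_prod_type, ← Finset.smul_sum, hv]
      · have h (ω' : ι × Bool) : branchSetoid ι (0 + 1) ω ω' ↔ ω.1 = ω'.1 := Iff.rfl
        simp [h, branchProcess, Finset.sum_filter, Fintype.sum_prod_type]
      · exact Finset.sum_eq_zero fun ω' _ => sub_self _
  refine ⟨⟨ι × Bool, p, hprob, S, branchProcess g v f, hmart⟩, hwp, fun ω => rfl, ?_⟩
  rintro ⟨i, b⟩
  refine ⟨i, rfl, ?_⟩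
  cases b
  exacts [Or.inr rfl, Or.inl rfl]

/-- Key lemma: given a finite family `𝒢 = {G_1, …, G_m}` (`m ≥ 2`) of nonempty open sets
and `g ∈ C(K)`, there is a three-step martingale `(N_0, N_1, N_2)` with `Ω_2 = Ω`,
`N_0 ≡ g`, `±dN_2(ω) ∈ ℱ_𝒢`, and `‖N_2(ω)‖∞ ≤ max(‖g‖∞, 1) + l(𝒢)/(m - 1)`. -/
theorem stmt15 {K : Type*} [TopologicalSpace K] [CompactSpace K] [T2Space K]
    (fG : Set K → C(K, ℝ))
    (hfG : ∀ G : Set K, IsOpen G → G.Nonempty →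
      (∀ x, 0 ≤ fG G x) ∧ (∀ x, fG G x ≤ 1) ∧ ‖fG G‖ = 1 ∧ ∀ x ∉ G, fG G x = 0)
    (𝒢 : Finset (Set K)) (h𝒢 : ∀ G ∈ 𝒢, IsOpen G ∧ G.Nonempty) (hcard : 2 ≤ 𝒢.card)
    (g : C(K, ℝ)) :
    ∃ T : MartingaleData C(K, ℝ),
      T.S.wpUnion 2 = Set.univ ∧
      (∀ ω, T.M 0 ω = g) ∧
      (∀ ω, (∃ G ∈ 𝒢, T.M 2 ω - T.M 1 ω = fG G) ∨
             (∃ G ∈ 𝒢, -(T.M 2 ω - T.M 1 ω) = fG G)) ∧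
      (∀ ω, ‖T.M 2 ω‖ ≤ max ‖g‖ 1 + (interNum 𝒢 : ℝ) / ((𝒢.card : ℝ) - 1)) := by
  classical
  have hm : (2 : ℝ) ≤ 𝒢.card := by exact_mod_cast hcard
  have hF (G : Set K) (hG : G ∈ 𝒢) := hfG G (h𝒢 G hG).1 (h𝒢 G hG).2
  let u : C(K, ℝ) := ⟨fun x => max (-1) (min 1 (g x)), by fun_prop⟩
  let w : C(K, ℝ) := (𝒢.card : ℝ)⁻¹ • ∑ G ∈ 𝒢, fG G * u
  let e := 𝒢.equivFin
  let F : Fin 𝒢.card → C(K, ℝ) := fun i => fG (e.symm i)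
  have hsum (h : Set K → C(K, ℝ)) : ∑ i, h (e.symm i) = ∑ G ∈ 𝒢, h G := by
    rw [Equiv.sum_comp e.symm (fun G : 𝒢 => h G), Finset.sum_coe_sort 𝒢 h]
  have hv : ∑ i, (w - F i * u) = 0 := by
    rw [hsum (fun G => w - fG G * u), Finset.sum_sub_distrib, Finset.sum_const, sub_eq_zero,
      ← Nat.cast_smul_eq_nsmul ℝ, smul_inv_smul₀ (by linarith)]
  have hw (x : K) : |w x| ≤ interNum 𝒢 / ((𝒢.card : ℝ) - 1) := by
    have hs0 : 0 ≤ ∑ G ∈ 𝒢, fG G x := Finset.sum_nonneg fun G hG => (hF G hG).1 x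
    have hs : ∑ G ∈ 𝒢, fG G x ≤ interNum 𝒢 :=
      sum_le_interNum 𝒢 (fun G => fG G x) x (fun G hG => (hF G hG).2.1 x)
        (fun G hG => (hF G hG).2.2.2 x)
    have hwx : w x = (∑ G ∈ 𝒢, fG G x) / 𝒢.card * max (-1) (min 1 (g x)) := by
      simp only [w, u, ← Finset.sum_mul, ContinuousMap.smul_apply, ContinuousMap.mul_apply,
        ContinuousMap.sum_apply, ContinuousMap.coe_mk, smul_eq_mul]
      ring
    rw [hwx, abs_mul, abs_of_nonneg (by positivity)]
    calc (∑ G ∈ 𝒢, fG G x) / 𝒢.card * |max (-1) (min 1 (g x))|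
        ≤ (∑ G ∈ 𝒢, fG G x) / 𝒢.card :=
          mul_le_of_le_one_right (by positivity) (abs_truncation_le_one _)
      _ ≤ interNum 𝒢 / ((𝒢.card : ℝ) - 1) :=
          div_le_div₀ (Nat.cast_nonneg _) hs (by linarith) (by linarith)
  have : Nonempty (Fin 𝒢.card) := ⟨⟨0, by omega⟩⟩
  obtain ⟨T, hT, hT0, hT1⟩ := exists_branching_martingaleData g (fun i => w - F i * u) F hv
  have hbound (i : Fin 𝒢.card) (s : C(K, ℝ)) (hs : s = F i ∨ s = -F i) :
      ‖g + (w - F i * u) + s‖ ≤ max ‖g‖ 1 + interNum 𝒢 / ((𝒢.card : ℝ) - 1) := by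
    have hFi := hF _ (e.symm i).2
    have hl : 0 ≤ interNum 𝒢 / ((𝒢.card : ℝ) - 1) :=
      div_nonneg (Nat.cast_nonneg _) (by linarith)
    rw [ContinuousMap.norm_le _ (by positivity)]
    intro x
    have hsx : |s x| = F i x := by
      rcases hs with rfl | rfl
      · exact abs_of_nonneg (hFi.1 x)
      · rw [ContinuousMap.neg_apply, abs_neg]
        exact abs_of_nonneg (hFi.1 x)
    have hg : max |g x| 1 ≤ max ‖g‖ 1 := max_le_max_right 1 (g.norm_coe_le_norm x)
    have hkey : |g x - F i x * u x| + F i x ≤ max |g x| 1 :=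
      abs_sub_mul_truncation_add_le (hFi.2.1 x)
    calc ‖(g + (w - F i * u) + s) x‖ = |(g x - F i x * u x) + s x + w x| := by
          rw [Real.norm_eq_abs]
          congr 1
          simp only [ContinuousMap.add_apply, ContinuousMap.sub_apply, ContinuousMap.mul_apply]
          ring
      _ ≤ |g x - F i x * u x| + |s x| + |w x| := abs_add_three _ _ _
      _ ≤ max ‖g‖ 1 + interNum 𝒢 / ((𝒢.card : ℝ) - 1) := by
          rw [hsx]
          exact add_le_add (hkey.trans hg) (hw x)
  refine ⟨T, hT, hT0, fun ω => ?_, fun ω => ?_⟩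
  · obtain ⟨i, h1, h2 | h2⟩ := hT1 ω
    · exact Or.inl ⟨_, (e.symm i).2, by rw [h1, h2, add_sub_cancel_left]⟩
    · exact Or.inr ⟨_, (e.symm i).2, by rw [h1, h2, add_sub_cancel_left, neg_neg]⟩
  · obtain ⟨i, -, h2 | h2⟩ := hT1 ω
    · rw [h2]
      exact hbound i _ (Or.inl rfl)
    · rw [h2]
      exact hbound i _ (Or.inr rfl)
end
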